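/- Classification theorem (multisymplectic case, N > 1): a smooth vector field X on ℝ^{(N+1)(n+1)} is locally hamiltonian for ω if and only if (1) X^μ depends only on the x-coordinates, X^i depends only on (x,q), and (2) there exist smooth functions f_0^μ of (x,q) such that X_i^μ = − p_j^μ ∂X^j/∂q^i + p_i^ν ∂X^μ/∂x^ν − p_i^μ ∂X^ν/∂x^ν + ∂f_0^μ/∂q^i and X_0 = − p ∂X^μ/∂x^μ − p_i^μ ∂X^i/∂x^μ + ∂f_0^μ/∂x^μ. -/

import Mathlib

open scoped BigOperators

namespace MPS

variable (n N : ℕ)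

/-- The multiphase space with base dimension `n+2` and `N` field components:
coordinates `(x^μ, q^i, p_i^μ, p)`. -/
abbrev Pt := (Fin (n+2) → ℝ) × (Fin N → ℝ) × (Fin N → Fin (n+2) → ℝ) × ℝ

/-- A `k`-form on `Pt`, represented by its values on `k`-tuples of (constant) vectors. -/
abbrev Form (k : ℕ) := Pt n N → (Fin k → Pt n N) → ℝ

/-- The covector `dx^μ`. -/
def cx (μ : Fin (n+2)) : Pt n N → ℝ := fun z => z.1 μ
/-- The covector `dq^i`. -/
def cq (i : Fin N) : Pt n N → ℝ := fun z => z.2.1 i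
/-- The covector `dp_i^μ`. -/
def cp (i : Fin N) (μ : Fin (n+2)) : Pt n N → ℝ := fun z => z.2.2.1 i μ
/-- The covector `dp` (energy). -/
def cE : Pt n N → ℝ := fun z => z.2.2.2

/-- The coordinate vector `∂/∂x^μ`. -/
def ex (μ : Fin (n+2)) : Pt n N := (Pi.single μ 1, 0, 0, 0)
/-- The coordinate vector `∂/∂q^i`. -/
def eq (i : Fin N) : Pt n N := (0, Pi.single i 1, 0, 0)
/-- The coordinate vector `∂/∂p_i^μ`. -/
def ep (i : Fin N) (μ : Fin (n+2)) : Pt n N := (0, 0, Pi.single i (Pi.single μ 1), 0)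
/-- The coordinate vector `∂/∂p`. -/
def eE : Pt n N := (0, 0, 0, 1)

/-- Wedge of a (constant-coefficient) 1-form with a `k`-form. -/
def wedge1 {k : ℕ} (α : Pt n N → ℝ) (β : (Fin k → Pt n N) → ℝ) :
    (Fin (k+1) → Pt n N) → ℝ :=
  fun v => ∑ j : Fin (k+1), (-1 : ℝ) ^ (j : ℕ) * α (v j) * β (v ∘ j.succAbove)

/-- The volume covector `d^n x = dx^1 ∧ … ∧ dx^n`. -/
def vol : (Fin (n+2) → Pt n N) → ℝ :=
  fun v => Matrix.det (Matrix.of fun a b => (v b).1 a)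

/-- `d^n x_μ = i_{∂_μ} d^n x`. -/
def volm (μ : Fin (n+2)) : (Fin (n+1) → Pt n N) → ℝ :=
  fun v => vol n N (Fin.cons (ex n N μ) v)

/-- The canonical multisymplectic form
`ω = dq^i ∧ dp_i^μ ∧ d^n x_μ − dp ∧ d^n x`. -/
def omega : Form n N (n+3) :=
  fun _ v =>
    (∑ i : Fin N, ∑ μ : Fin (n+2),
      wedge1 n N (cq n N i) (wedge1 n N (cp n N i μ) (volm n N μ)) v)
    - wedge1 n N (cE n N) (vol n N) v

/-- The multicanonical form `θ = p_i^μ dq^i ∧ d^n x_μ + p d^n x`. -/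
def theta : Form n N (n+2) :=
  fun z v =>
    (∑ i : Fin N, ∑ μ : Fin (n+2),
      z.2.2.1 i μ * wedge1 n N (cq n N i) (volm n N μ) v)
    + z.2.2.2 * vol n N v

/-- Exterior derivative of a `k`-form on the vector space `Pt`. -/
noncomputable def extd {k : ℕ} (ω : Form n N k) : Form n N (k+1) :=
  fun x v => ∑ j : Fin (k+1), (-1 : ℝ) ^ (j : ℕ) *
    fderiv ℝ (fun y => ω y (v ∘ j.succAbove)) x (v j)

/-- Interior product of a vector field with a `(k+1)`-form. -/
def iVF {k : ℕ} (X : Pt n N → Pt n N) (ω : Form n N (k+1)) : Form n N k :=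
  fun x v => ω x (Fin.cons (X x) v)

/-- Lie derivative of a `(k+1)`-form along a vector field (Cartan's formula). -/
noncomputable def lieD {k : ℕ} (X : Pt n N → Pt n N) (ω : Form n N (k+1)) : Form n N (k+1) :=
  fun x v => extd n N (iVF n N X ω) x v + iVF n N X (extd n N ω) x v

/-- Lie bracket of vector fields on `Pt`. -/
noncomputable def lieB (X Y : Pt n N → Pt n N) : Pt n N → Pt n N :=
  fun z => fderiv ℝ Y z (X z) - fderiv ℝ X z (Y z)

/-- `d^n x_{μν} = i_{∂_ν} i_{∂_μ} d^n x`. -/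
def volmn (μ ν : Fin (n+2)) : (Fin n → Pt n N) → ℝ :=
  fun v => vol n N (Fin.cons (ex n N μ) (Fin.cons (ex n N ν) v))

/-- Partial derivative `∂f/∂x^μ`. -/
noncomputable def pdx (f : Pt n N → ℝ) (z : Pt n N) (μ : Fin (n+2)) : ℝ :=
  fderiv ℝ f z (ex n N μ)

/-- Partial derivative `∂f/∂q^i`. -/
noncomputable def pdq (f : Pt n N → ℝ) (z : Pt n N) (i : Fin N) : ℝ :=
  fderiv ℝ f z (eq n N i)

/-- Partial derivative `∂f/∂p_i^μ`. -/
noncomputable def pdp (f : Pt n N → ℝ) (z : Pt n N) (i : Fin N) (μ : Fin (n+2)) : ℝ :=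
  fderiv ℝ f z (ep n N i μ)

/-- Partial derivative `∂f/∂p`. -/
noncomputable def pdE (f : Pt n N → ℝ) (z : Pt n N) : ℝ :=
  fderiv ℝ f z (eE n N)

end MPS


namespace MPS
section algebra
variable {n N : ℕ}

/-- linear versions of the covectors -/
def cqL (i : Fin N) : Pt n N →ₗ[ℝ] ℝ where
  toFun := cq n N i
  map_add' _ _ := rfl
  map_smul' _ _ := rfl
def cpL (i : Fin N) (μ : Fin (n+2)) : Pt n N →ₗ[ℝ] ℝ where
  toFun := cp n N i μ
  map_add' _ _ := rfl
  map_smul' _ _ := rfl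
def cEL : Pt n N →ₗ[ℝ] ℝ where
  toFun := cE n N
  map_add' _ _ := rfl
  map_smul' _ _ := rfl

noncomputable def W {k : ℕ} (α : Pt n N →ₗ[ℝ] ℝ) (β : Pt n N [⋀^Fin k]→ₗ[ℝ] ℝ) :
    Pt n N [⋀^Fin (k+1)]→ₗ[ℝ] ℝ :=
  AlternatingMap.alternatizeUncurryFin (α.smulRight β)

lemma W_apply {k : ℕ} (α : Pt n N →ₗ[ℝ] ℝ) (β : Pt n N [⋀^Fin k]→ₗ[ℝ] ℝ) :
    ⇑(W α β) = wedge1 n N α β := by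
  funext v
  simp only [W, AlternatingMap.alternatizeUncurryFin_apply, wedge1]
  refine Finset.sum_congr rfl fun j _ => ?_
  simp only [LinearMap.smulRight_apply, AlternatingMap.smul_apply, smul_eq_mul, zsmul_eq_mul]
  push_cast
  rw [mul_assoc]
  rfl

noncomputable def volA : Pt n N [⋀^Fin (n+2)]→ₗ[ℝ] ℝ :=
  (Matrix.detRowAlternating (n := Fin (n+2)) (R := ℝ)).compLinearMap
    (LinearMap.fst ℝ (Fin (n+2) → ℝ) _)

lemma volA_apply : ⇑(volA (n := n) (N := N)) = vol n N := by
  funext v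
  simp only [vol]
  rw [← Matrix.det_transpose]
  rfl

noncomputable def volmA (μ : Fin (n+2)) : Pt n N [⋀^Fin (n+1)]→ₗ[ℝ] ℝ :=
  volA.curryLeft (ex n N μ)

lemma volmA_apply (μ : Fin (n+2)) : ⇑(volmA (N := N) μ) = volm n N μ := by
  funext v
  simp only [volm, volmA, AlternatingMap.curryLeft_apply_apply, volA_apply]
  rfl

lemma altsum_apply {k : ℕ} {ι : Type*} (s : Finset ι) (f : ι → Pt n N [⋀^Fin k]→ₗ[ℝ] ℝ)
    (v : Fin k → Pt n N) : (∑ x ∈ s, f x) v = ∑ x ∈ s, f x v := by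
  classical
  induction s using Finset.induction_on with
  | empty => simp
  | insert a s ha ih => rw [Finset.sum_insert ha, Finset.sum_insert ha, ← ih]; rfl

noncomputable def omA : Pt n N [⋀^Fin (n+3)]→ₗ[ℝ] ℝ :=
  (∑ i : Fin N, ∑ μ : Fin (n+2), W (cqL i) (W (cpL i μ) (volmA μ))) - W cEL volA

lemma omA_apply (z : Pt n N) : ⇑(omA (n := n) (N := N)) = omega n N z := by
  funext v
  simp only [omA, omega, AlternatingMap.sub_apply, W_apply, volA_apply]
  rw [altsum_apply]
  simp only [altsum_apply, W_apply, volmA_apply]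
  rfl

/-- derivation action of an endomorphism -/
def Lop {k : ℕ} (A : Pt n N → Pt n N) (β : (Fin k → Pt n N) → ℝ) : (Fin k → Pt n N) → ℝ :=
  fun v => ∑ j, β (Function.update v j (A (v j)))

lemma alt_cyc {k : ℕ} (β : Pt n N [⋀^Fin (k+1)]→ₗ[ℝ] ℝ) (u : Pt n N) (v : Fin (k+1) → Pt n N)
    (j : Fin (k+1)) :
    β (Function.update v j u) = (-1 : ℝ) ^ (j : ℕ) * β (Fin.cons u (v ∘ j.succAbove)) := by
  rw [← Fin.insertNth_removeNth, AlternatingMap.map_insertNth]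
  simp only [zsmul_eq_mul]
  push_cast
  rfl

lemma lieD_eq (X : Pt n N → Pt n N) (hX : Differentiable ℝ X) (z : Pt n N)
    (v : Fin (n+3) → Pt n N) :
    lieD n N X (omega n N) z v = Lop (fderiv ℝ X z) (omA (n := n) (N := N)) v := by
  have h2 : extd n N (omega n N) = 0 := by
    funext x v
    simp only [extd]
    refine Finset.sum_eq_zero fun j _ => ?_
    have : (fun y => omega n N y (v ∘ j.succAbove)) = fun _ => omega n N 0 (v ∘ j.succAbove) := rfl
    rw [this]
    simp
  have h0 : lieD n N X (omega n N) z v = extd n N (iVF n N X (omega n N)) z v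
      + extd n N (omega n N) z (Fin.cons (X z) v) := rfl
  rw [h0, h2, Pi.zero_apply, Pi.zero_apply, add_zero]
  simp only [iVF, extd, Lop]
  refine Finset.sum_congr rfl fun j _ => ?_
  rw [alt_cyc]
  congr 1
  let ℓ : Pt n N →ₗ[ℝ] ℝ :=
    { toFun := fun u => omA.curryLeft u (v ∘ j.succAbove)
      map_add' := by intro a b; simp only [map_add]; rfl
      map_smul' := by intro a b; simp only [map_smul]; rfl }
  have h3 : (fun y => omega n N y (Fin.cons (X y) (v ∘ j.succAbove)))
      = fun y => (LinearMap.toContinuousLinearMap ℓ) (X y) := by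
    funext y
    rw [← omA_apply y]
    rfl
  rw [h3]
  have := ((LinearMap.toContinuousLinearMap ℓ).hasFDerivAt.comp z (hX z).hasFDerivAt).fderiv
  rw [Function.comp_def] at this
  rw [this]
  rfl

/-- Leibniz rule -/
lemma Lop_wedge {k : ℕ} (A : Pt n N → Pt n N) (α : Pt n N → ℝ) (β : (Fin k → Pt n N) → ℝ)
    (v : Fin (k+1) → Pt n N) :
    Lop A (wedge1 n N α β) v
      = wedge1 n N (fun u => α (A u)) β v + wedge1 n N α (Lop A β) v := by
  simp only [Lop, wedge1]
  rw [Finset.sum_comm, ← Finset.sum_add_distrib]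
  refine Finset.sum_congr rfl fun j _ => ?_
  rw [Fin.sum_univ_succAbove _ j, Finset.mul_sum]
  congr 1
  · simp only [Function.update_self]
    congr 2
    funext l
    simp
  · refine Finset.sum_congr rfl fun l _ => ?_
    rw [Function.update_of_ne (Fin.succAbove_ne j l).symm]
    congr 2
    funext m
    by_cases h : m = l
    · subst h; simp
    · have : j.succAbove m ≠ j.succAbove l := fun h' => h (Fin.succAbove_right_injective h')
      simp [Function.update_of_ne h, Function.update_of_ne this]

lemma Lop_cons {k : ℕ} (A : Pt n N → Pt n N) (β : (Fin (k+1) → Pt n N) → ℝ) (a : Pt n N)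
    (v : Fin k → Pt n N) :
    Lop A β (Fin.cons a v) = β (Fin.cons (A a) v) + Lop A (fun w => β (Fin.cons a w)) v := by
  simp only [Lop]
  rw [Fin.sum_univ_succ]
  congr 1
  · simp [Fin.update_cons_zero]
  · refine Finset.sum_congr rfl fun j _ => ?_
    simp [Fin.cons_update]

lemma wedge_cons {k : ℕ} (α : Pt n N → ℝ) (β : (Fin (k+1) → Pt n N) → ℝ) (a : Pt n N)
    (v : Fin (k+1) → Pt n N) :
    wedge1 n N α β (Fin.cons a v) = α a * β v - wedge1 n N α (fun w => β (Fin.cons a w)) v := by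
  simp only [wedge1]
  rw [Fin.sum_univ_succ, sub_eq_add_neg, ← Finset.sum_neg_distrib]
  congr 1
  · simp
  · refine Finset.sum_congr rfl fun j _ => ?_
    have : (Fin.cons a v : Fin (k+2) → Pt n N) ∘ (Fin.succ j).succAbove
        = Fin.cons a (v ∘ j.succAbove) := by
      funext m
      refine Fin.cases ?_ (fun m => ?_) m
      · simp
      · simp
    rw [this]
    simp [pow_succ]

lemma wedge_sum_left {k : ℕ} {ι : Type*} (s : Finset ι) (c : ι → ℝ) (α : ι → Pt n N → ℝ)
    (β : (Fin k → Pt n N) → ℝ) (v : Fin (k+1) → Pt n N) :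
    wedge1 n N (fun u => ∑ x ∈ s, c x * α x u) β v = ∑ x ∈ s, c x * wedge1 n N (α x) β v := by
  simp only [wedge1, Finset.mul_sum, Finset.sum_mul]
  rw [Finset.sum_comm]
  refine Finset.sum_congr rfl fun _ _ => Finset.sum_congr rfl fun _ _ => by ring

lemma wedge_sum_right {k : ℕ} {ι : Type*} (s : Finset ι) (c : ι → ℝ) (α : Pt n N → ℝ)
    (β : ι → (Fin k → Pt n N) → ℝ) (v : Fin (k+1) → Pt n N) :
    wedge1 n N α (fun u => ∑ x ∈ s, c x * β x u) v = ∑ x ∈ s, c x * wedge1 n N α (β x) v := by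
  simp only [wedge1, Finset.mul_sum]
  rw [Finset.sum_comm]
  refine Finset.sum_congr rfl fun _ _ => Finset.sum_congr rfl fun _ _ => by ring

lemma wedge_add_left {k : ℕ} (α α' : Pt n N → ℝ)
    (β : (Fin k → Pt n N) → ℝ) (v : Fin (k+1) → Pt n N) :
    wedge1 n N (fun u => α u + α' u) β v = wedge1 n N α β v + wedge1 n N α' β v := by
  simp only [wedge1, ← Finset.sum_add_distrib]
  refine Finset.sum_congr rfl fun _ _ => by ring

lemma wedge_sub_left {k : ℕ} (α α' : Pt n N → ℝ)
    (β : (Fin k → Pt n N) → ℝ) (v : Fin (k+1) → Pt n N) :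
    wedge1 n N (fun u => α u - α' u) β v = wedge1 n N α β v - wedge1 n N α' β v := by
  simp only [wedge1, ← Finset.sum_sub_distrib]
  refine Finset.sum_congr rfl fun _ _ => by ring

lemma wedge_smul_left {k : ℕ} (c : ℝ) (α : Pt n N → ℝ)
    (β : (Fin k → Pt n N) → ℝ) (v : Fin (k+1) → Pt n N) :
    wedge1 n N (fun u => c * α u) β v = c * wedge1 n N α β v := by
  simp only [wedge1, Finset.mul_sum]
  refine Finset.sum_congr rfl fun _ _ => by ring

lemma wedge_add_right {k : ℕ} (α : Pt n N → ℝ)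
    (β β' : (Fin k → Pt n N) → ℝ) (v : Fin (k+1) → Pt n N) :
    wedge1 n N α (fun u => β u + β' u) v = wedge1 n N α β v + wedge1 n N α β' v := by
  simp only [wedge1, ← Finset.sum_add_distrib]
  refine Finset.sum_congr rfl fun _ _ => by ring

lemma wedge_sub_right {k : ℕ} (α : Pt n N → ℝ)
    (β β' : (Fin k → Pt n N) → ℝ) (v : Fin (k+1) → Pt n N) :
    wedge1 n N α (fun u => β u - β' u) v = wedge1 n N α β v - wedge1 n N α β' v := by
  simp only [wedge1, ← Finset.sum_sub_distrib]
  refine Finset.sum_congr rfl fun _ _ => by ring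

lemma wedge_smul_right {k : ℕ} (c : ℝ) (α : Pt n N → ℝ)
    (β : (Fin k → Pt n N) → ℝ) (v : Fin (k+1) → Pt n N) :
    wedge1 n N α (fun u => c * β u) v = c * wedge1 n N α β v := by
  simp only [wedge1, Finset.mul_sum]
  refine Finset.sum_congr rfl fun _ _ => by ring

lemma wedge_swap {k : ℕ} (α β : Pt n N →ₗ[ℝ] ℝ) (γ : Pt n N [⋀^Fin k]→ₗ[ℝ] ℝ)
    (v : Fin (k+2) → Pt n N) :
    wedge1 n N α (wedge1 n N β γ) v = - wedge1 n N β (wedge1 n N α γ) v := by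
  have key := AlternatingMap.alternatizeUncurryFin_alternatizeUncurryFinLM_comp_of_symmetric
    (f := α.smulRight (β.smulRight γ) + β.smulRight (α.smulRight γ)) (by
      intro x y
      ext w
      simp
      ring)
  have h2 : W α (W β γ) + W β (W α γ) = 0 := by
    rw [← key, LinearMap.comp_add, AlternatingMap.alternatizeUncurryFin_add]
    congr 1
    · simp only [W]
      congr 1
      refine LinearMap.ext fun x => ?_
      simp only [LinearMap.smulRight_apply, LinearMap.comp_apply,
        AlternatingMap.alternatizeUncurryFinLM_apply]
      rw [← AlternatingMap.alternatizeUncurryFin_smul]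
    · simp only [W]
      congr 1
      refine LinearMap.ext fun x => ?_
      simp only [LinearMap.smulRight_apply, LinearMap.comp_apply,
        AlternatingMap.alternatizeUncurryFinLM_apply]
      rw [← AlternatingMap.alternatizeUncurryFin_smul]
  have := congrArg (fun f => f v) h2
  simp only [AlternatingMap.add_apply, W_apply, AlternatingMap.zero_apply] at this
  linarith

end algebra
end MPS


namespace MPS
section algebra2
variable {n N : ℕ}

lemma vol_update (v : Fin (n+2) → Pt n N) (j : Fin (n+2)) (a : Pt n N) :
    vol n N (Function.update v j a)
      = Matrix.cramer (Matrix.of fun a b => (v b).1 a) a.1 j := by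
  rw [Matrix.cramer_apply, vol]
  congr 1
  ext x y
  by_cases h : y = j
  · subst h; simp
  · simp [h]

lemma Lop_vol (A : Pt n N → Pt n N) (B : Matrix (Fin (n+2)) (Fin (n+2)) ℝ)
    (hB : ∀ w, (A w).1 = B.mulVec w.1) (v : Fin (n+2) → Pt n N) :
    Lop A (vol n N) v = B.trace * vol n N v := by
  set V : Matrix (Fin (n+2)) (Fin (n+2)) ℝ := Matrix.of fun a b => (v b).1 a with hV
  have h1 : ∀ j, vol n N (Function.update v j (A (v j))) = (V.adjugate * (B * V)) j j := by
    intro j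
    rw [vol_update, Matrix.cramer_eq_adjugate_mulVec, hB]
    rw [Matrix.mul_apply]
    rfl
  simp only [Lop, h1]
  have : ∑ j, (V.adjugate * (B * V)) j j = (V.adjugate * (B * V)).trace := rfl
  rw [this, Matrix.trace_mul_comm, Matrix.mul_assoc, Matrix.mul_adjugate]
  simp [mul_comm, vol, hV]

lemma vol_zero_cons (a : Pt n N) (ha : a.1 = 0) (w : Fin (n+1) → Pt n N) :
    vol n N (Fin.cons a w) = 0 := by
  rw [vol]
  apply Matrix.det_eq_zero_of_column_eq_zero 0
  intro i
  simp [ha]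

lemma alt_swap {k : ℕ} (β : Pt n N [⋀^Fin (k+2)]→ₗ[ℝ] ℝ) (a b : Pt n N) (w : Fin k → Pt n N) :
    β (Fin.cons a (Fin.cons b w)) = - β (Fin.cons b (Fin.cons a w)) := by
  have h := alt_cyc β b (Fin.cons a (Fin.cons b w)) 1
  have h1 : Function.update (Fin.cons a (Fin.cons b w) : Fin (k+2) → Pt n N) 1 b
      = Fin.cons a (Fin.cons b w) := by
    rw [Function.update_eq_self_iff]
    rfl
  have h2 : (Fin.cons a (Fin.cons b w) : Fin (k+2) → Pt n N) ∘ (1 : Fin (k+2)).succAbove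
      = Fin.cons a w := by
    funext m
    refine Fin.cases ?_ (fun m => ?_) m
    · rfl
    · have : (1 : Fin (k+2)).succAbove m.succ = m.succ.succ :=
        Fin.succAbove_of_le_castSucc _ _ (by simp [Fin.le_def])
      simp [this]
  rw [h1, h2] at h
  rw [h]
  simp

lemma vol_swap (a b : Pt n N) (w : Fin n → Pt n N) :
    vol n N (Fin.cons a (Fin.cons b w)) = - vol n N (Fin.cons b (Fin.cons a w)) := by
  have h := alt_swap volA a b w
  rwa [volA_apply] at h

lemma vol_cons (a : Pt n N) (w : Fin (n+1) → Pt n N) :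
    vol n N (Fin.cons a w) = ∑ μ, a.1 μ * volm n N μ w := by
  have h : a = (∑ μ, a.1 μ • ex n N μ) + (0, a.2) := by
    ext x
    · simp [ex, Prod.fst_sum, Finset.sum_apply, Pi.single_apply]
    · simp [ex, Prod.snd_sum]
    · simp [ex, Prod.snd_sum]
    · simp [ex, Prod.snd_sum]
  have h1 : ∀ a, vol n N (Fin.cons a w) = volA.curryLeft a w := by
    intro a
    rw [AlternatingMap.curryLeft_apply_apply, volA_apply]; rfl
  rw [h1, h]
  rw [map_add, AlternatingMap.add_apply, ← h1 (0, a.2), vol_zero_cons _ rfl, map_sum, altsum_apply,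
    add_zero, ← h]
  refine Finset.sum_congr rfl fun μ _ => ?_
  rw [map_smul, AlternatingMap.smul_apply, ← h1]
  rfl

lemma Lop_volm (A : Pt n N → Pt n N) (B : Matrix (Fin (n+2)) (Fin (n+2)) ℝ)
    (hB : ∀ w, (A w).1 = B.mulVec w.1) (μ : Fin (n+2)) (v : Fin (n+1) → Pt n N) :
    Lop A (volm n N μ) v = B.trace * volm n N μ v - ∑ ν, B ν μ * volm n N ν v := by
  have h := Lop_cons A (vol n N) (ex n N μ) v
  rw [Lop_vol A B hB, vol_cons (A _)] at h
  have h2 : ∀ ν, (A (ex n N μ)).1 ν = B ν μ := by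
    intro ν
    rw [hB]
    simp [ex]
  simp only [h2] at h
  have h3 : Lop A (volm n N μ) v = Lop A (fun w => vol n N (Fin.cons (ex n N μ) w)) v := rfl
  rw [h3]
  have h4 : volm n N μ v = vol n N (Fin.cons (ex n N μ) v) := rfl
  rw [h4]
  linarith

lemma wedge_cx_volm (ν μ : Fin (n+2)) (v : Fin (n+2) → Pt n N) :
    wedge1 n N (cx n N ν) (volm n N μ) v = if ν = μ then vol n N v else 0 := by
  set V : Matrix (Fin (n+2)) (Fin (n+2)) ℝ := Matrix.of fun a b => (v b).1 a with hV
  have h : ∀ j : Fin (n+2), (-1 : ℝ) ^ (j : ℕ) * cx n N ν (v j) * volm n N μ (v ∘ j.succAbove)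
      = V ν j * V.cramer (Pi.single μ 1) j := by
    intro j
    have := alt_cyc volA (ex n N μ) v j
    rw [volA_apply, vol_update] at this
    have h2 : V.cramer (Pi.single μ 1) j = _ := this
    rw [h2]
    have h3 : volm n N μ (v ∘ j.succAbove) = vol n N (Fin.cons (ex n N μ) (v ∘ j.succAbove)) := rfl
    have h4 : V ν j = cx n N ν (v j) := rfl
    rw [h3, h4]
    ring
  simp only [wedge1, h]
  have h5 : ∑ j, V ν j * V.cramer (Pi.single μ 1) j = (V.mulVec (V.cramer (Pi.single μ 1))) ν := rfl
  rw [h5, Matrix.mulVec_cramer]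
  have h6 : vol n N v = V.det := rfl
  rw [h6]
  simp [Pi.single_apply]

lemma wedge_cx_vol (ν : Fin (n+2)) (v : Fin (n+3) → Pt n N) :
    wedge1 n N (cx n N ν) (vol n N) v = 0 := by
  let M : Matrix (Fin (n+3)) (Fin (n+3)) ℝ :=
    Matrix.of (Fin.cons (fun j => (v j).1 ν) (fun a j => (v j).1 a))
  have h0 : M.det = 0 := by
    apply Matrix.det_zero_of_row_eq (i := 0) (j := ν.succ) (by simp [eq_comm])
    funext j
    simp [M]
  rw [← h0, Matrix.det_succ_row_zero]
  rfl

/-- the reduced two-form -/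
def Om (a b : Pt n N) (μ : Fin (n+2)) : ℝ :=
  ∑ i, (a.2.1 i * b.2.2.1 i μ - b.2.1 i * a.2.2.1 i μ)

lemma wedge_zero_right {k : ℕ} (α : Pt n N → ℝ) (v : Fin (k+1) → Pt n N) :
    wedge1 n N α (fun _ => 0) v = 0 := by
  simp [wedge1]

lemma volm_zero_cons (μ : Fin (n+2)) (a : Pt n N) (ha : a.1 = 0) (w : Fin n → Pt n N) :
    volm n N μ (Fin.cons a w) = 0 := by
  have : volm n N μ (Fin.cons a w) = vol n N (Fin.cons (ex n N μ) (Fin.cons a w)) := rfl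
  rw [this, vol_swap, vol_zero_cons a ha, neg_zero]

lemma wedge_volm_vert (α : Pt n N → ℝ) (μ : Fin (n+2)) (a : Pt n N) (ha : a.1 = 0)
    (w : Fin (n+1) → Pt n N) :
    wedge1 n N α (volm n N μ) (Fin.cons a w) = α a * volm n N μ w := by
  rw [wedge_cons]
  simp only [volm_zero_cons μ a ha]
  rw [wedge_zero_right, sub_zero]

lemma omega_vert1 (z : Pt n N) (a : Pt n N) (ha : a.1 = 0) (w : Fin (n+2) → Pt n N) :
    omega n N z (Fin.cons a w) =
      (∑ i, ∑ μ, (a.2.1 i * wedge1 n N (cp n N i μ) (volm n N μ) w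
        - a.2.2.1 i μ * wedge1 n N (cq n N i) (volm n N μ) w)) - a.2.2.2 * vol n N w := by
  simp only [omega, wedge_cons, wedge_volm_vert _ _ a ha, vol_zero_cons a ha, wedge_zero_right,
    wedge_smul_right]
  simp [cp, cq, cE]

lemma omega_vert2 (z : Pt n N) (a b : Pt n N) (ha : a.1 = 0) (hb : b.1 = 0)
    (w : Fin (n+1) → Pt n N) :
    omega n N z (Fin.cons a (Fin.cons b w)) = ∑ μ, Om a b μ * volm n N μ w := by
  have := omega_vert1 z a ha (Fin.cons b w)
  rw [this]
  simp only [wedge_volm_vert _ _ b hb, vol_zero_cons b hb, Om, Finset.sum_mul, mul_zero, sub_zero]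
  rw [Finset.sum_comm]
  refine Finset.sum_congr rfl fun i _ => Finset.sum_congr rfl fun μ _ => ?_
  simp only [cp, cq]
  ring

def eb (n N : ℕ) : Fin (n+2) → Pt n N := fun μ => ex n N μ

lemma vol_eb_update (ν : Fin (n+2)) (a : Pt n N) :
    vol n N (Function.update (eb n N) ν a) = a.1 ν := by
  rw [vol_update]
  have : (Matrix.of fun a b => (eb n N b).1 a) = (1 : Matrix (Fin (n+2)) (Fin (n+2)) ℝ) := by
    ext x y
    simp [eb, ex, Matrix.one_apply, Pi.single_apply]
  rw [this]
  simp

lemma nondeg1 (u : Fin (n+2) → ℝ)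
    (h : ∀ w : Fin (n+1) → Pt n N, ∑ μ, u μ * volm n N μ w = 0) (ν : Fin (n+2)) : u ν = 0 := by
  have h1 := vol_eb_update (N := N) ν (u, 0, 0, 0)
  have h2 := alt_cyc volA (u, 0, 0, 0) (eb n N) ν
  rw [volA_apply, h1, vol_cons] at h2
  have h3 := h (eb n N ∘ ν.succAbove)
  simp only at h2
  rw [h2, h3, mul_zero]

lemma nondeg2 (μ : Fin (n+2)) (a : Pt n N)
    (h : ∀ w : Fin n → Pt n N, volm n N μ (Fin.cons a w) = 0) (ν : Fin (n+2)) (hν : ν ≠ μ) :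
    a.1 ν = 0 := by
  obtain ⟨k, rfl⟩ := Fin.exists_succAbove_eq hν
  set v := Function.update (eb n N) (μ.succAbove k) a with hv
  have h1 : vol n N v = a.1 (μ.succAbove k) := vol_eb_update _ a
  have h2 : v = Function.update v μ (ex n N μ) := by
    symm
    rw [Function.update_eq_self_iff, hv, Function.update_of_ne hν.symm]
    rfl
  have h3 := alt_cyc volA (ex n N μ) v μ
  rw [← h2, volA_apply, h1] at h3
  have h4 : v ∘ μ.succAbove = Function.update (v ∘ μ.succAbove) k a := by
    symm
    rw [Function.update_eq_self_iff, hv]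
    simp
  have h5 := alt_cyc (volmA μ) a (v ∘ μ.succAbove) k
  rw [← h4, volmA_apply, h, mul_zero] at h5
  have h6 : vol n N (Fin.cons (ex n N μ) (v ∘ μ.succAbove)) = 0 := h5
  rw [h3, h6, mul_zero]

end algebra2
end MPS


namespace MPS
section algebra3
variable {n N : ℕ}

lemma Lop_om_vert2 (A : Pt n N →ₗ[ℝ] Pt n N) (a b : Pt n N) (ha : a.1 = 0) (hb : b.1 = 0)
    (w : Fin (n+1) → Pt n N) :
    Lop A (omA (n := n) (N := N)) (Fin.cons a (Fin.cons b w))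
      = omega n N 0 (Fin.cons (A a) (Fin.cons b w)) + omega n N 0 (Fin.cons a (Fin.cons (A b) w))
        + Lop A (fun w => ∑ μ, Om a b μ * volm n N μ w) w := by
  rw [omA_apply 0, Lop_cons, Lop_cons, ← add_assoc]
  congr 2
  funext w
  exact omega_vert2 0 a b ha hb w

lemma Lop_sum {k : ℕ} {ι : Type*} (s : Finset ι) (A : Pt n N → Pt n N) (c : ι → ℝ)
    (β : ι → (Fin k → Pt n N) → ℝ) (v : Fin k → Pt n N) :
    Lop A (fun w => ∑ x ∈ s, c x * β x w) v = ∑ x ∈ s, c x * Lop A (β x) v := by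
  simp only [Lop, Finset.mul_sum]
  rw [Finset.sum_comm]

lemma Om_antisymm (a b : Pt n N) (μ : Fin (n+2)) : Om a b μ = - Om b a μ := by
  simp only [Om]
  rw [← Finset.sum_neg_distrib]
  exact Finset.sum_congr rfl fun i _ => by ring

lemma Om_eq_left (i : Fin N) (b : Pt n N) (ρ : Fin (n+2)) : Om (eq n N i) b ρ = b.2.2.1 i ρ := by
  simp [Om, eq, Pi.single_apply]

lemma Om_ep_right (i : Fin N) (μ : Fin (n+2)) (a : Pt n N) (ρ : Fin (n+2)) :
    Om a (ep n N i μ) ρ = if ρ = μ then a.2.1 i else 0 := by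
  have : ∀ k, (Pi.single i (Pi.single μ 1) : Fin N → Fin (n+2) → ℝ) k ρ
      = if k = i then (if ρ = μ then 1 else 0) else 0 := by
    intro k
    by_cases h : k = i
    · subst h; simp [Pi.single_apply]
    · simp [h]
  simp [Om, ep, this]

lemma omega_rot (u b c : Pt n N) (hb : b.1 = 0) (hc : c.1 = 0) (w : Fin n → Pt n N) :
    omega n N 0 (Fin.cons u (Fin.cons b (Fin.cons c w)))
      = ∑ μ, Om b c μ * volm n N μ (Fin.cons u w) := by
  rw [← omega_vert2 0 b c hb hc, ← omA_apply 0, alt_swap]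
  have := alt_swap (omA.curryLeft b) u c w
  have h2 : omA (Fin.cons b (Fin.cons u (Fin.cons c w)))
    = - omA (Fin.cons b (Fin.cons c (Fin.cons u w))) := this
  rw [h2, neg_neg]

lemma forward1 (A : Pt n N →ₗ[ℝ] Pt n N)
    (hA : ∀ v, Lop A (omA (n := n) (N := N)) v = 0) (a : Pt n N) (ha : a.1 = 0)
    (i : Fin N) (h1 : a.2.1 i = 0) (h2 : a.2.2.1 i = 0) (ν : Fin (n+2)) : (A a).1 ν = 0 := by
  obtain ⟨μ, hμ⟩ := exists_ne ν
  refine nondeg2 μ (A a) (fun w => ?_) ν hμ.symm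
  have h := hA (Fin.cons (eq n N i) (Fin.cons (ep n N i μ) (Fin.cons a w)))
  rw [Lop_om_vert2 A _ _ rfl rfl, Lop_cons] at h
  have s1 : omega n N 0 (Fin.cons (A (eq n N i)) (Fin.cons (ep n N i μ) (Fin.cons a w))) = 0 := by
    rw [omega_rot _ _ _ rfl ha]
    refine Finset.sum_eq_zero fun ρ _ => ?_
    rw [Om_antisymm, Om_ep_right, h1]
    simp
  have s2 : omega n N 0 (Fin.cons (eq n N i) (Fin.cons (A (ep n N i μ)) (Fin.cons a w))) = 0 := by
    rw [← omA_apply 0, alt_swap, omA_apply 0, omega_rot _ _ _ rfl ha]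
    rw [neg_eq_zero]
    refine Finset.sum_eq_zero fun ρ _ => ?_
    rw [Om_eq_left, h2]
    simp
  have s3 : Lop A (fun w => ∑ ρ, Om (eq n N i) (ep n N i μ) ρ * volm n N ρ (Fin.cons a w)) w
      = 0 := by
    simp only [volm_zero_cons _ a ha, mul_zero, Finset.sum_const_zero]
    simp [Lop]
  rw [s1, s2, s3] at h
  simpa [Om_ep_right, eq] using h

lemma forward1' (hN : 1 < N) (A : Pt n N →ₗ[ℝ] Pt n N)
    (hA : ∀ v, Lop A (omA (n := n) (N := N)) v = 0) (a : Pt n N) (ha : a.1 = 0) : (A a).1 = 0 := by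
  let i : Fin N := ⟨0, by omega⟩
  let j : Fin N := ⟨1, hN⟩
  have hij : j ≠ i := by simp [i, j]
  let a1 : Pt n N := (0, Function.update a.2.1 i 0, Function.update a.2.2.1 i 0, a.2.2.2)
  let a2 : Pt n N := (0, Pi.single i (a.2.1 i), Pi.single i (a.2.2.1 i), 0)
  have h : a = a1 + a2 := by
    refine Prod.ext ?_ (Prod.ext ?_ (Prod.ext ?_ ?_))
    · simp [a1, a2, ha]
    · funext k
      by_cases h : k = i
      · subst h; simp [a1, a2]
      · simp [a1, a2, h]
    · funext k
      by_cases h : k = i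
      · subst h; simp [a1, a2]
      · simp [a1, a2, h]
    · simp [a1, a2]
  funext ν
  rw [h, map_add, Prod.fst_add, Pi.add_apply,
    forward1 A hA a1 rfl i (by simp [a1]) (by simp [a1]),
    forward1 A hA a2 rfl j (by simp [a2, hij]) (by simp [a2, hij])]
  simp

/-- the pointwise conditions -/
structure Conds (A : Pt n N →ₗ[ℝ] Pt n N) : Prop where
  c1 : ∀ a : Pt n N, a.1 = 0 → (A a).1 = 0
  c2 : ∀ a b : Pt n N, a.1 = 0 → b.1 = 0 → ∀ μ,
    Om (A a) b μ + Om a (A b) μ + (∑ ν, (A (ex n N ν)).1 ν) * Om a b μ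
      - ∑ ν, (A (ex n N ν)).1 μ * Om a b ν = 0
  c3 : ∀ a : Pt n N, a.1 = 0 →
    - (A a).2.2.2 + (∑ i, ∑ μ, (a.2.1 i * (A (ex n N μ)).2.2.1 i μ
      - a.2.2.1 i μ * (A (ex n N μ)).2.1 i)) - a.2.2.2 * (∑ ν, (A (ex n N ν)).1 ν) = 0

lemma basis_exp (u : Pt n N) : u = (∑ ν, cx n N ν u • ex n N ν) + (∑ k, cq n N k u • eq n N k)
    + (∑ j, ∑ ρ, cp n N j ρ u • ep n N j ρ) + cE n N u • eE n N := by
  have : ∀ (k j : Fin N) (ρ ν : Fin (n+2)),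
      (Pi.single k (Pi.single ρ 1) : Fin N → Fin (n+2) → ℝ) j ν
      = if k = j then (if ν = ρ then 1 else 0) else 0 := by
    intro k j ρ ν
    by_cases h : k = j
    · subst h; simp [Pi.single_apply]
    · simp [h, Ne.symm h]
  refine Prod.ext ?_ (Prod.ext ?_ (Prod.ext ?_ ?_))
  · funext x
    simp [cx, cq, cp, cE, ex, eq, ep, eE, Prod.fst_sum, Prod.snd_sum, Finset.sum_apply,
      Pi.single_apply]
  · funext x
    simp [cx, cq, cp, cE, ex, eq, ep, eE, Prod.fst_sum, Prod.snd_sum, Finset.sum_apply,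
      Pi.single_apply]
  · funext x y
    simp [cx, cq, cp, cE, ex, eq, ep, eE, Prod.fst_sum, Prod.snd_sum, Finset.sum_apply, this]
  · simp [cx, cq, cp, cE, ex, eq, ep, eE, Prod.snd_sum]

def Bm (A : Pt n N →ₗ[ℝ] Pt n N) : Matrix (Fin (n+2)) (Fin (n+2)) ℝ :=
  Matrix.of fun μ ν => (A (ex n N ν)).1 μ

lemma Bm_trace (A : Pt n N →ₗ[ℝ] Pt n N) : (Bm A).trace = ∑ ν, (A (ex n N ν)).1 ν := rfl

lemma Bm_mul (A : Pt n N →ₗ[ℝ] Pt n N) (h : ∀ a : Pt n N, a.1 = 0 → (A a).1 = 0) (w : Pt n N) :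
    (A w).1 = (Bm A).mulVec w.1 := by
  have hw : w = (∑ ν, w.1 ν • ex n N ν) + (0, w.2) := by
    refine Prod.ext ?_ ?_
    · funext x
      simp [ex, Prod.fst_sum, Finset.sum_apply, Pi.single_apply]
    · simp [ex, Prod.snd_sum]
  have h2 : A w = A ((∑ ν, w.1 ν • ex n N ν) + (0, w.2)) := by rw [← hw]
  rw [h2, map_add, Prod.fst_add, h (0, w.2) rfl, add_zero, map_sum, Prod.fst_sum]
  funext x
  simp only [Finset.sum_apply, Matrix.mulVec, dotProduct, map_smul]
  refine Finset.sum_congr rfl fun ν _ => ?_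
  simp [Bm, mul_comm]

lemma forward (hN : 1 < N) (A : Pt n N →ₗ[ℝ] Pt n N)
    (hA : ∀ v, Lop A (omA (n := n) (N := N)) v = 0) : Conds A := by
  have c1 := forward1' hN A hA
  have hB := Bm_mul A c1
  refine ⟨c1, ?_, ?_⟩
  · intro a b ha hb μ
    refine nondeg1 (N := N) (fun μ => Om (A a) b μ + Om a (A b) μ
      + (∑ ν, (A (ex n N ν)).1 ν) * Om a b μ - ∑ ν, (A (ex n N ν)).1 μ * Om a b ν) (fun w => ?_) μ
    have h := hA (Fin.cons a (Fin.cons b w))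
    rw [Lop_om_vert2 A a b ha hb, omega_vert2 0 _ _ (c1 a ha) hb,
      omega_vert2 0 _ _ ha (c1 b hb), Lop_sum] at h
    simp only [Lop_volm A (Bm A) hB, Bm_trace] at h
    rw [← h]
    simp only [mul_sub, add_mul, sub_mul, Finset.sum_add_distrib, Finset.sum_sub_distrib,
      Finset.sum_mul, Finset.mul_sum, add_sub_assoc]
    congr 2
    · exact Finset.sum_congr rfl fun _ _ => Finset.sum_congr rfl fun _ _ => by ring
    · rw [Finset.sum_comm]
      refine Finset.sum_congr rfl fun _ _ => Finset.sum_congr rfl fun _ _ => ?_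
      simp only [Bm, Matrix.of_apply]
      ring
  · intro a ha
    have h := hA (Fin.cons a (eb n N))
    rw [omA_apply 0, Lop_cons, omega_vert1 0 _ (c1 a ha)] at h
    have w1 : ∀ (α : Pt n N → ℝ) (hα : ∀ μ, α (ex n N μ) = 0) (μ : Fin (n+2)) (u : Pt n N)
        (ρ : Fin (n+2)), wedge1 n N α (volm n N μ) (Function.update (eb n N) ρ u)
          = if μ = ρ then α u else 0 := by
      intro α hα μ u ρ
      rw [wedge1, Finset.sum_eq_single ρ]
      · have e1 := alt_cyc volA (ex n N μ) (eb n N) ρ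
        rw [volA_apply, vol_eb_update] at e1
        have e2 : (Function.update (eb n N) ρ u) ∘ ρ.succAbove = eb n N ∘ ρ.succAbove := by
          funext l
          simp
        have e3 : volm n N μ (eb n N ∘ ρ.succAbove)
          = vol n N (Fin.cons (ex n N μ) (eb n N ∘ ρ.succAbove)) := rfl
        rw [e2, e3, Function.update_self, mul_comm _ (α u), mul_assoc, ← e1]
        simp [ex, Pi.single_apply, eq_comm]
      · intro j _ hj
        rw [Function.update_of_ne hj]
        simp [eb, hα]
      · simp
    have w0 : ∀ (α : Pt n N → ℝ) (hα : ∀ μ, α (ex n N μ) = 0) (μ : Fin (n+2)),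
        wedge1 n N α (volm n N μ) (eb n N) = 0 := by
      intro α hα μ
      simp [wedge1, eb, hα]
    have e4 : vol n N (eb n N) = 1 := by
      have := vol_eb_update (N := N) 0 (ex n N 0)
      have h : Function.update (eb n N) 0 (ex n N 0) = eb n N := by
        rw [Function.update_eq_self_iff]; rfl
      rw [h] at this
      simpa [ex] using this
    have hp : ∀ i μ ν, cp n N i μ (ex n N ν) = 0 := fun _ _ _ => rfl
    have hq : ∀ i ν, cq n N i (ex n N ν) = 0 := fun _ _ => rfl
    simp only [w0 _ (hp _ _), w0 _ (hq _), e4, Lop, omega_vert1 0 a ha, w1 _ (hp _ _),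
      w1 _ (hq _), vol_eb_update] at h
    simp only [mul_zero, sub_zero, Finset.sum_const_zero, mul_one, zero_sub, mul_ite,
      Finset.sum_sub_distrib] at h
    have e5 : ∀ f : Fin N → Fin (n+2) → Fin (n+2) → ℝ,
        ∑ x, ∑ i, ∑ μ, (if μ = x then f i μ x else 0) = ∑ i, ∑ μ, f i μ μ := by
      intro f
      rw [Finset.sum_comm]
      refine Finset.sum_congr rfl fun i _ => ?_
      rw [Finset.sum_comm]
      simp
    rw [e5, e5, ← Finset.mul_sum] at h
    rw [← h]
    simp only [Finset.sum_sub_distrib, eb, cp, cq]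
    ring

end algebra3
end MPS


namespace MPS
section algebra4
variable {n N : ℕ}

/-- the conditions in components -/
structure Coefs (A : Pt n N →ₗ[ℝ] Pt n N) : Prop where
  x_q : ∀ k, (A (eq n N k)).1 = 0
  x_p : ∀ j ρ, (A (ep n N j ρ)).1 = 0
  x_E : (A (eE n N)).1 = 0
  q_p : ∀ j ρ, (A (ep n N j ρ)).2.1 = 0
  q_E : (A (eE n N)).2.1 = 0
  p_p : ∀ j ρ i μ, (A (ep n N j ρ)).2.2.1 i μ = - (if μ = ρ then (A (eq n N i)).2.1 j else 0)
    + (if i = j then (A (ex n N ρ)).1 μ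
        - (if μ = ρ then ∑ ν, (A (ex n N ν)).1 ν else 0) else 0)
  p_E : ∀ i μ, (A (eE n N)).2.2.1 i μ = 0
  p_q : ∀ i k μ, (A (eq n N k)).2.2.1 i μ = (A (eq n N i)).2.2.1 k μ
  E_E : (A (eE n N)).2.2.2 = - ∑ ν, (A (ex n N ν)).1 ν
  E_p : ∀ i μ, (A (ep n N i μ)).2.2.2 = - (A (ex n N μ)).2.1 i
  E_q : ∀ i, (A (eq n N i)).2.2.2 = ∑ μ, (A (ex n N μ)).2.2.1 i μ

lemma single_single (k j : Fin N) (ρ ν : Fin (n+2)) :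
      (Pi.single k (Pi.single ρ 1) : Fin N → Fin (n+2) → ℝ) j ν
      = if j = k then (if ν = ρ then 1 else 0) else 0 := by
  by_cases h : j = k
  · subst h; simp [Pi.single_apply]
  · simp [h]

lemma Conds.coefs {A : Pt n N →ₗ[ℝ] Pt n N} (h : Conds A) : Coefs A where
  x_q k := h.c1 _ rfl
  x_p j ρ := h.c1 _ rfl
  x_E := h.c1 _ rfl
  q_p j ρ := by
    funext i
    obtain ⟨μ, hμ⟩ := exists_ne ρ
    have := h.c2 (ep n N j ρ) (ep n N i μ) rfl rfl μ
    have e1 : Om (ep n N j ρ) (A (ep n N i μ)) μ = 0 := by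
      rw [Om_antisymm, Om_ep_right, if_neg hμ, neg_zero]
    have e2 : ∀ ν, Om (ep n N j ρ) (ep n N i μ) ν = 0 := by
      intro ν
      rw [Om_ep_right]
      simp [ep]
    rw [e1] at this
    simp only [e2, Om_ep_right] at this
    simpa using this
  q_E := by
    funext i
    have := h.c2 (eE n N) (ep n N i 0) rfl rfl 0
    have e1 : ∀ b ν, Om (eE n N) b ν = 0 := by
      intro b ν
      simp [Om, eE]
    simp only [e1, Om_ep_right] at this
    simpa using this
  p_p j ρ i μ := by
    have := h.c2 (eq n N i) (ep n N j ρ) rfl rfl μ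
    have e : ∀ ν, Om (eq n N i) (ep n N j ρ) ν = if i = j then (if ν = ρ then 1 else 0) else 0 := by
      intro ν
      rw [Om_eq_left]
      exact single_single _ _ _ _
    rw [Om_ep_right, Om_eq_left] at this
    simp only [e] at this
    split_ifs at this ⊢ <;> simp at this ⊢ <;> linarith
  p_E i μ := by
    have := h.c2 (eq n N i) (eE n N) rfl rfl μ
    have e1 : ∀ b ν, Om b (eE n N) ν = 0 := by
      intro b ν
      simp [Om, eE]
    simp only [e1, Om_eq_left] at this
    simpa using this
  p_q i k μ := by
    have := h.c2 (eq n N i) (eq n N k) rfl rfl μ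
    rw [Om_antisymm (A _)] at this
    simp only [Om_eq_left] at this
    have e : ∀ ν, (eq n N k).2.2.1 i ν = 0 := fun _ => rfl
    simp [e] at this
    linarith
  E_E := by
    have := h.c3 (eE n N) rfl
    simp [eE] at this ⊢
    linarith
  E_p i μ := by
    have := h.c3 (ep n N i μ) rfl
    simp [ep, single_single] at this ⊢
    linarith
  E_q i := by
    have := h.c3 (eq n N i) rfl
    simp [eq, Pi.single_apply] at this ⊢
    linarith

lemma Coefs.c1 {A : Pt n N →ₗ[ℝ] Pt n N} (h : Coefs A) (a : Pt n N) (ha : a.1 = 0) :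
    (A a).1 = 0 := by
  rw [basis_exp a]
  simp only [map_add, map_sum, map_smul, Prod.fst_add, Prod.fst_sum, Prod.smul_fst, h.x_q, h.x_p,
    h.x_E, cx, ha]
  simp

lemma Coefs.cq_exp {A : Pt n N →ₗ[ℝ] Pt n N} (h : Coefs A) (i : Fin N) (u : Pt n N) :
    cq n N i (A u) = (∑ ν, (A (ex n N ν)).2.1 i * cx n N ν u)
      + ∑ k, (A (eq n N k)).2.1 i * cq n N k u := by
  have : A u = _ := congrArg A (basis_exp u)
  rw [this]
  simp only [map_add, map_sum, map_smul, cq, Prod.fst_add, Prod.snd_add, Prod.fst_sum,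
    Prod.snd_sum, Prod.smul_fst, Prod.smul_snd, h.q_p, h.q_E]
  simp [Finset.sum_apply, mul_comm]

lemma Coefs.cp_exp {A : Pt n N →ₗ[ℝ] Pt n N} (h : Coefs A) (i : Fin N) (μ : Fin (n+2))
    (u : Pt n N) :
    cp n N i μ (A u) = (∑ ν, (A (ex n N ν)).2.2.1 i μ * cx n N ν u)
      + (∑ k, (A (eq n N k)).2.2.1 i μ * cq n N k u)
      - (∑ j, (A (eq n N i)).2.1 j * cp n N j μ u)
      + (∑ ρ, (A (ex n N ρ)).1 μ * cp n N i ρ u)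
      - (∑ ν, (A (ex n N ν)).1 ν) * cp n N i μ u := by
  have : A u = _ := congrArg A (basis_exp u)
  rw [this]
  simp only [map_add, map_sum, map_smul, cp, Prod.fst_add, Prod.snd_add, Prod.fst_sum,
    Prod.snd_sum, Prod.smul_fst, Prod.smul_snd, Finset.sum_apply, Pi.add_apply, Pi.smul_apply,
    h.p_p, h.p_E, smul_eq_mul, mul_add, mul_neg, mul_ite, mul_sub, mul_zero,
    Finset.sum_add_distrib, Finset.sum_neg_distrib, Finset.sum_ite_eq, Finset.mem_univ, if_true]
  have e : ∀ f : Fin N → Fin (n+2) → ℝ, (∑ x, ∑ y, if i = x then f x y else 0) = ∑ y, f i y := by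
    intro f
    rw [Finset.sum_comm]
    simp
  rw [e]
  simp only [Finset.sum_sub_distrib, Finset.sum_ite_eq, Finset.mem_univ, if_true]
  simp only [mul_comm]
  ring

lemma Coefs.cE_exp {A : Pt n N →ₗ[ℝ] Pt n N} (h : Coefs A) (u : Pt n N) :
    cE n N (A u) = (∑ ν, (A (ex n N ν)).2.2.2 * cx n N ν u)
      + (∑ k, (∑ μ, (A (ex n N μ)).2.2.1 k μ) * cq n N k u)
      - (∑ j, ∑ ρ, (A (ex n N ρ)).2.1 j * cp n N j ρ u)
      - (∑ ν, (A (ex n N ν)).1 ν) * cE n N u := by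
  have : A u = _ := congrArg A (basis_exp u)
  rw [this]
  simp only [map_add, map_sum, map_smul, cE, Prod.snd_add,
    Prod.snd_sum, Prod.smul_snd, h.E_p, h.E_E, h.E_q, smul_eq_mul, mul_neg, Finset.sum_neg_distrib]
  simp only [mul_comm]
  ring

lemma wedge_sum2_left {k : ℕ} {ι κ : Type*} (s : Finset ι) (t : Finset κ) (c : ι → κ → ℝ)
    (α : ι → κ → Pt n N → ℝ)
    (β : (Fin k → Pt n N) → ℝ) (v : Fin (k+1) → Pt n N) :
    wedge1 n N (fun u => ∑ x ∈ s, ∑ y ∈ t, c x y * α x y u) β v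
      = ∑ x ∈ s, ∑ y ∈ t, c x y * wedge1 n N (α x y) β v := by
  have := wedge_sum_left s (fun _ => 1) (fun x u => ∑ y ∈ t, c x y * α x y u) β v
  simp only [one_mul] at this
  rw [this]
  exact Finset.sum_congr rfl fun x _ => wedge_sum_left _ _ _ _ _

def cxL (i : Fin (n+2)) : Pt n N →ₗ[ℝ] ℝ where
  toFun := cx n N i
  map_add' _ _ := rfl
  map_smul' _ _ := rfl

lemma Lop_omega (A : Pt n N → Pt n N) (v : Fin (n+3) → Pt n N) :
    Lop A (omega n N 0) v = (∑ i : Fin N, ∑ μ : Fin (n+2),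
      Lop A (wedge1 n N (cq n N i) (wedge1 n N (cp n N i μ) (volm n N μ))) v)
    - Lop A (wedge1 n N (cE n N) (vol n N)) v := by
  simp only [Lop, omega, Finset.sum_sub_distrib]
  congr 1
  rw [Finset.sum_comm]
  refine Finset.sum_congr rfl fun i _ => ?_
  rw [Finset.sum_comm]

lemma Coefs.lop {A : Pt n N →ₗ[ℝ] Pt n N} (h : Coefs A) (v : Fin (n+3) → Pt n N) :
    Lop A (omA (n := n) (N := N)) v = 0 := by
  have hB := Bm_mul A h.c1
  rw [omA_apply 0, Lop_omega]
  have l1 : Lop A (vol n N) = fun w => (∑ ν, (A (ex n N ν)).1 ν) * vol n N w := by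
    funext w
    rw [Lop_vol A _ hB, Bm_trace]
  have l2 : ∀ μ, Lop A (volm n N μ) = fun w => (∑ ν, (A (ex n N ν)).1 ν) * volm n N μ w
      - ∑ ν, (A (ex n N μ)).1 ν * volm n N ν w := by
    intro μ
    funext w
    rw [Lop_volm A _ hB, Bm_trace]
    rfl
  have l3 : ∀ i μ, Lop A (wedge1 n N (cp n N i μ) (volm n N μ)) = fun w =>
      wedge1 n N (fun u => cp n N i μ (A u)) (volm n N μ) w
      + wedge1 n N (cp n N i μ) (Lop A (volm n N μ)) w := by
    intro i μ
    funext w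
    rw [Lop_wedge]
  have s1 : ∀ ν i μ, wedge1 n N (cx n N ν) (wedge1 n N (cp n N i μ) (volm n N μ)) v
      = - if ν = μ then wedge1 n N (cp n N i μ) (vol n N) v else 0 := by
    intro ν i μ
    have := wedge_swap (cxL ν) (cpL i μ) (volmA (N := N) μ) v
    rw [volmA_apply] at this
    have e : wedge1 n N (cx n N ν) (wedge1 n N (cp n N i μ) (volm n N μ)) v
      = - wedge1 n N (cp n N i μ) (wedge1 n N (cx n N ν) (volm n N μ)) v := this
    rw [e]
    have e2 : wedge1 n N (cx n N ν) (volm n N μ) = fun w => if ν = μ then vol n N w else 0 := by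
      funext w
      exact wedge_cx_volm ν μ w
    rw [e2]
    split_ifs
    · rfl
    · rw [wedge_zero_right]
  have s2 : ∀ k i μ, wedge1 n N (cq n N i) (wedge1 n N (cq n N k) (volm n N μ)) v
      = - wedge1 n N (cq n N k) (wedge1 n N (cq n N i) (volm n N μ)) v := by
    intro k i μ
    have := wedge_swap (cqL i) (cqL k) (volmA (N := N) μ) v
    rw [volmA_apply] at this
    exact this
  have s3 : ∀ (ν : Fin (n+2)) i μ, wedge1 n N (cq n N i) (fun w => if ν = μ then vol n N w else 0) v
      = if ν = μ then wedge1 n N (cq n N i) (vol n N) v else 0 := by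
    intro ν i μ
    split_ifs
    · rfl
    · rw [wedge_zero_right]
  simp only [Lop_wedge, l1, l2, l3, h.cq_exp, h.cp_exp, h.cE_exp, wedge_add_left, wedge_add_right,
    wedge_sub_left, wedge_sub_right, wedge_smul_left, wedge_smul_right, wedge_sum2_left,
    wedge_sum_left, wedge_sum_right, wedge_cx_vol, wedge_cx_volm, s1, s3]
  generalize (∑ ν, (A (ex n N ν)).1 ν) = T
  have E1 : ∑ i : Fin N, ∑ μ : Fin (n+2), ∑ k : Fin N, (A (eq n N k)).2.1 i *
        wedge1 n N (cq n N k) (wedge1 n N (cp n N i μ) (volm n N μ)) v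
      = ∑ i : Fin N, ∑ μ : Fin (n+2), ∑ k : Fin N, (A (eq n N i)).2.1 k *
        wedge1 n N (cq n N i) (wedge1 n N (cp n N k μ) (volm n N μ)) v := by
    rw [Finset.sum_comm]
    conv_rhs => rw [Finset.sum_comm]
    refine Finset.sum_congr rfl fun μ _ => ?_
    rw [Finset.sum_comm]
  have E2 : ∑ i : Fin N, ∑ μ : Fin (n+2), ∑ k : Fin N, (A (eq n N k)).2.2.1 i μ *
        wedge1 n N (cq n N i) (wedge1 n N (cq n N k) (volm n N μ)) v = 0 := by
    rw [Finset.sum_comm]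
    refine Finset.sum_eq_zero fun μ _ => ?_
    have e : ∑ i : Fin N, ∑ k : Fin N, (A (eq n N k)).2.2.1 i μ *
        wedge1 n N (cq n N i) (wedge1 n N (cq n N k) (volm n N μ)) v
        = - ∑ i : Fin N, ∑ k : Fin N, (A (eq n N k)).2.2.1 i μ *
        wedge1 n N (cq n N i) (wedge1 n N (cq n N k) (volm n N μ)) v := by
      conv_lhs => rw [Finset.sum_comm]
      simp only [← Finset.sum_neg_distrib]
      refine Finset.sum_congr rfl fun i _ => Finset.sum_congr rfl fun k _ => ?_
      rw [s2 i k μ, h.p_q k i μ]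
      ring
    linarith
  have E3 : ∑ i : Fin N, ∑ μ : Fin (n+2), ∑ ν : Fin (n+2), (A (ex n N ν)).1 μ *
        wedge1 n N (cq n N i) (wedge1 n N (cp n N i ν) (volm n N μ)) v
      = ∑ i : Fin N, ∑ μ : Fin (n+2), ∑ ν : Fin (n+2), (A (ex n N μ)).1 ν *
        wedge1 n N (cq n N i) (wedge1 n N (cp n N i μ) (volm n N ν)) v := by
    refine Finset.sum_congr rfl fun μ _ => ?_
    rw [Finset.sum_comm]
  simp only [mul_neg, mul_ite, mul_zero, Finset.sum_neg_distrib, Finset.sum_ite_eq',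
    Finset.mem_univ, if_true, Finset.sum_const_zero, Finset.sum_add_distrib,
    Finset.sum_sub_distrib, Finset.sum_mul]
  rw [E1, E2, E3]
  ring

end algebra4
end MPS


namespace MPS
section analysis

lemma hasFDerivAt_param {H E : Type} [NormedAddCommGroup H] [NormedSpace ℝ H] [ProperSpace H]
    [NormedAddCommGroup E] [NormedSpace ℝ E] [CompleteSpace E] (G : ℝ × H → E)
    (hG : ContDiff ℝ 1 G) (y : H) :
    HasFDerivAt (fun y => ∫ t in (0:ℝ)..1, G (t, y))
      (∫ t in (0:ℝ)..1, (fderiv ℝ G (t, y)).comp (ContinuousLinearMap.inr ℝ ℝ H)) y := by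
  have hd : Continuous (fun p : ℝ × H => (fderiv ℝ G p).comp (ContinuousLinearMap.inr ℝ ℝ H)) := by
    have := hG.continuous_fderiv one_ne_zero
    fun_prop
  have hGc := hG.continuous
  obtain ⟨C, hC⟩ := (isCompact_Icc.prod (isCompact_closedBall y 1) :
    IsCompact (Set.Icc (0:ℝ) 1 ×ˢ Metric.closedBall y 1)).exists_bound_of_continuousOn
      hd.continuousOn
  refine intervalIntegral.hasFDerivAt_integral_of_dominated_of_fderiv_le
    (F := fun y t => G (t, y))
    (F' := fun y t => (fderiv ℝ G (t, y)).comp (ContinuousLinearMap.inr ℝ ℝ H))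
    (s := Metric.ball y 1) (bound := fun _ => C)
    (Metric.ball_mem_nhds y one_pos) ?_ ?_ ?_ ?_ ?_ ?_
  · refine Filter.Eventually.of_forall fun x => ?_
    exact (by fun_prop : Continuous fun t => G (t, x)).aestronglyMeasurable
  · exact (by fun_prop : Continuous fun t => G (t, y)).intervalIntegrable _ _
  · exact (hd.comp (by fun_prop : Continuous fun t : ℝ => (t, y))).aestronglyMeasurable
  · refine Filter.Eventually.of_forall fun t ht x hx => ?_
    rw [Set.uIoc_of_le zero_le_one] at ht
    exact hC (t, x) ⟨⟨ht.1.le, ht.2⟩, Metric.ball_subset_closedBall hx⟩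
  · exact intervalIntegrable_const
  · refine Filter.Eventually.of_forall fun t ht x hx => ?_
    have h1 := ((hG.differentiable one_ne_zero) (t, x)).hasFDerivAt
    exact h1.comp x (hasFDerivAt_prodMk_right t x)

lemma contDiff_param_nat {H : Type} [NormedAddCommGroup H] [NormedSpace ℝ H] [ProperSpace H]
    (k : ℕ) : ∀ {E : Type} [NormedAddCommGroup E] [NormedSpace ℝ E] [CompleteSpace E]
    (G : ℝ × H → E) (_ : ContDiff ℝ (⊤ : ℕ∞) G),
    ContDiff ℝ k (fun y => ∫ t in (0:ℝ)..1, G (t, y)) := by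
  induction k with
  | zero =>
    intro E _ _ _ G hG
    have hG1 : ContDiff ℝ 1 G := hG.of_le (by exact_mod_cast le_top)
    have : Differentiable ℝ (fun y => ∫ t in (0:ℝ)..1, G (t, y)) :=
      fun y => (hasFDerivAt_param G hG1 y).differentiableAt
    exact contDiff_zero.2 this.continuous
  | succ k ih =>
    intro E _ _ _ G hG
    have hG1 : ContDiff ℝ 1 G := hG.of_le (by exact_mod_cast le_top)
    have hd : ContDiff ℝ (⊤ : ℕ∞)
        (fun p : ℝ × H => (fderiv ℝ G p).comp (ContinuousLinearMap.inr ℝ ℝ H)) := by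
      have : ContDiff ℝ (⊤ : ℕ∞) (fderiv ℝ G) := hG.fderiv_right (by exact_mod_cast le_top)
      exact this.clm_comp contDiff_const
    have := contDiff_succ_iff_hasFDerivAt (𝕜 := ℝ) (n := k)
      (f := fun y => ∫ t in (0:ℝ)..1, G (t, y))
    push_cast
    rw [this]
    exact ⟨_, ih _ hd, hasFDerivAt_param G hG1⟩

lemma contDiff_param {H : Type} [NormedAddCommGroup H] [NormedSpace ℝ H] [ProperSpace H]
    {E : Type} [NormedAddCommGroup E] [NormedSpace ℝ E] [CompleteSpace E]
    (G : ℝ × H → E) (hG : ContDiff ℝ (⊤ : ℕ∞) G) :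
    ContDiff ℝ (⊤ : ℕ∞) (fun y => ∫ t in (0:ℝ)..1, G (t, y)) :=
  contDiff_infty.2 fun k => contDiff_param_nat k G hG

lemma hasDerivAt_line {H E : Type} [NormedAddCommGroup H] [NormedSpace ℝ H]
    [NormedAddCommGroup E] [NormedSpace ℝ E] {F : H → E} (hF : Differentiable ℝ F) (z a : H)
    (s : ℝ) : HasDerivAt (fun s : ℝ => F (z + s • a)) (fderiv ℝ F (z + s • a) a) s := by
  have h1 : HasDerivAt (fun s : ℝ => z + s • a) a s := by
    simpa using ((hasDerivAt_id s).smul_const a).const_add z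
  exact (hF (z + s • a)).hasFDerivAt.comp_hasDerivAt s h1

lemma fderiv_of_line {H E : Type} [NormedAddCommGroup H] [NormedSpace ℝ H]
    [NormedAddCommGroup E] [NormedSpace ℝ E] {F : H → E} (hF : Differentiable ℝ F) (z a : H)
    {c : E} (h : HasDerivAt (fun s : ℝ => F (z + s • a)) c 0) : fderiv ℝ F z a = c := by
  have := hasDerivAt_line hF z a 0
  simp only [zero_smul, add_zero] at this
  exact this.unique h

lemma fderiv_param {H : Type} [NormedAddCommGroup H] [NormedSpace ℝ H] [ProperSpace H]
    (G : ℝ × H → ℝ) (hG : ContDiff ℝ (⊤ : ℕ∞) G) (z a : H) (g : ℝ → ℝ)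
    (hg : ∀ t, HasDerivAt (fun s : ℝ => G (t, z + s • a)) (g t) 0) :
    fderiv ℝ (fun y => ∫ t in (0:ℝ)..1, G (t, y)) z a = ∫ t in (0:ℝ)..1, g t := by
  have hG1 : ContDiff ℝ 1 G := hG.of_le (by exact_mod_cast le_top)
  have hd : Continuous (fun p : ℝ × H => (fderiv ℝ G p).comp (ContinuousLinearMap.inr ℝ ℝ H)) := by
    have := hG1.continuous_fderiv one_ne_zero
    fun_prop
  rw [(hasFDerivAt_param G hG1 z).fderiv, ContinuousLinearMap.intervalIntegral_apply]
  · congr 1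
    funext t
    have hF : Differentiable ℝ (fun y => G (t, y)) := by
      have := hG1.differentiable one_ne_zero
      fun_prop
    rw [← fderiv_of_line hF z a (hg t)]
    have h1 := ((hG1.differentiable one_ne_zero) (t, z)).hasFDerivAt
    have h2 := h1.comp z (hasFDerivAt_prodMk_right t z)
    have h3 := h2.fderiv
    rw [Function.comp_def] at h3
    rw [h3]
  · exact (hd.comp (by fun_prop : Continuous fun t : ℝ => (t, z))).intervalIntegrable _ _

lemma line_const {H E : Type} [NormedAddCommGroup H] [NormedSpace ℝ H]
    [NormedAddCommGroup E] [NormedSpace ℝ E] {F : H → E} (hF : Differentiable ℝ F) (z a : H)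
    (c : E) (h : ∀ s : ℝ, fderiv ℝ F (z + s • a) a = c) : F (z + a) = F z + c := by
  have h1 : ∀ s : ℝ, HasDerivAt (fun s : ℝ => F (z + s • a) - s • c) 0 s := by
    intro s
    have := (hasDerivAt_line hF z a s).fun_sub ((hasDerivAt_id s).smul_const c)
    rw [h s, one_smul, sub_self] at this
    exact this
  have h2 := is_const_of_deriv_eq_zero (fun s => (h1 s).differentiableAt)
    (fun s => (h1 s).deriv) 1 0
  simp at h2
  rw [← h2]
  abel

lemma fderiv_shift {H E : Type} [NormedAddCommGroup H] [NormedSpace ℝ H]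
    [NormedAddCommGroup E] [NormedSpace ℝ E] (F : H → E) (a : H) (h : ∀ y, F (y + a) = F y) (z : H) :
    fderiv ℝ F (z + a) = fderiv ℝ F z := by
  rw [← fderiv_comp_add_right]
  congr 1
  funext y
  exact h y

lemma snd_symm {H : Type} [NormedAddCommGroup H] [NormedSpace ℝ H] {F : H → ℝ}
    (hF : ContDiff ℝ (⊤ : ℕ∞) F) (z a b : H) :
    fderiv ℝ (fun y => fderiv ℝ F y a) z b = fderiv ℝ (fun y => fderiv ℝ F y b) z a := by
  have hd : Differentiable ℝ (fderiv ℝ F) :=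
    ((contDiff_infty.1 hF 2).fderiv_right (m := 1) (by norm_num)).differentiable one_ne_zero
  have e : ∀ a b, fderiv ℝ (fun y => fderiv ℝ F y a) z b = fderiv ℝ (fderiv ℝ F) z b a := by
    intro a b
    rw [fderiv_clm_apply (hd z) (differentiableAt_const a)]
    simp
  rw [e, e]
  have hs : IsSymmSndFDerivAt ℝ F z :=
    ((contDiff_infty.1 hF 2).contDiffAt).isSymmSndFDerivAt (by simp)
  exact hs b a

end analysis
end MPS


namespace MPS
section main
variable {n N : ℕ}

lemma hasDerivAt_lin {E : Type} [NormedAddCommGroup E] [NormedSpace ℝ E]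
    {X : Pt n N → Pt n N} (hX : Differentiable ℝ X) (L : Pt n N →L[ℝ] E)
    (γ : ℝ → Pt n N) (γ' : Pt n N) (t : ℝ) (h : HasDerivAt γ γ' t) :
    HasDerivAt (fun s => L (X (γ s))) (L (fderiv ℝ X (γ t) γ')) t := by
  have h1 := (hX (γ t)).hasFDerivAt.comp_hasDerivAt t h
  exact L.hasFDerivAt.comp_hasDerivAt t h1

lemma fderiv_lin {E : Type} [NormedAddCommGroup E] [NormedSpace ℝ E]
    {X : Pt n N → Pt n N} (hX : Differentiable ℝ X) (L : Pt n N →L[ℝ] E)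
    (z a : Pt n N) : fderiv ℝ (fun y => L (X y)) z a = L (fderiv ℝ X z a) := by
  have := (L.hasFDerivAt (x := X z)).comp z (hX z).hasFDerivAt
  have h3 := this.fderiv
  rw [Function.comp_def] at h3
  rw [h3]
  rfl

/-- continuous coordinate maps -/
noncomputable def Lx (μ : Fin (n+2)) : Pt n N →L[ℝ] ℝ :=
  (ContinuousLinearMap.proj μ).comp (ContinuousLinearMap.fst ℝ _ _)
noncomputable def Lq (i : Fin N) : Pt n N →L[ℝ] ℝ :=
  (ContinuousLinearMap.proj i).comp ((ContinuousLinearMap.fst ℝ _ _).comp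
    (ContinuousLinearMap.snd ℝ _ _))
noncomputable def Lp (i : Fin N) (μ : Fin (n+2)) : Pt n N →L[ℝ] ℝ :=
  (ContinuousLinearMap.proj μ : (Fin (n+2) → ℝ) →L[ℝ] ℝ).comp
  ((ContinuousLinearMap.proj i : (Fin N → Fin (n+2) → ℝ) →L[ℝ] (Fin (n+2) → ℝ)).comp
    ((ContinuousLinearMap.fst ℝ _ _).comp
    ((ContinuousLinearMap.snd ℝ _ _).comp (ContinuousLinearMap.snd ℝ _ _))))
noncomputable def LE : Pt n N →L[ℝ] ℝ :=
  ((ContinuousLinearMap.snd ℝ _ _).comp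
    ((ContinuousLinearMap.snd ℝ _ _).comp (ContinuousLinearMap.snd ℝ _ _)))

lemma Lx_apply (μ : Fin (n+2)) (z : Pt n N) : Lx μ z = z.1 μ := rfl
lemma Lq_apply (i : Fin N) (z : Pt n N) : Lq i z = z.2.1 i := rfl
lemma Lp_apply (i : Fin N) (μ : Fin (n+2)) (z : Pt n N) : Lp i μ z = z.2.2.1 i μ := rfl
lemma LE_apply (z : Pt n N) : LE z = z.2.2.2 := rfl

lemma fd_x {X : Pt n N → Pt n N} (hX : Differentiable ℝ X) (μ : Fin (n+2)) (z a : Pt n N) :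
    fderiv ℝ (fun y => (X y).1 μ) z a = (fderiv ℝ X z a).1 μ := fderiv_lin hX (Lx μ) z a
lemma fd_q {X : Pt n N → Pt n N} (hX : Differentiable ℝ X) (i : Fin N) (z a : Pt n N) :
    fderiv ℝ (fun y => (X y).2.1 i) z a = (fderiv ℝ X z a).2.1 i := fderiv_lin hX (Lq i) z a
lemma fd_p {X : Pt n N → Pt n N} (hX : Differentiable ℝ X) (i : Fin N) (μ : Fin (n+2))
    (z a : Pt n N) :
    fderiv ℝ (fun y => (X y).2.2.1 i μ) z a = (fderiv ℝ X z a).2.2.1 i μ :=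
  fderiv_lin hX (Lp i μ) z a
lemma fd_E {X : Pt n N → Pt n N} (hX : Differentiable ℝ X) (z a : Pt n N) :
    fderiv ℝ (fun y => (X y).2.2.2) z a = (fderiv ℝ X z a).2.2.2 := fderiv_lin hX LE z a

lemma fderiv_dep {E : Type} [NormedAddCommGroup E] [NormedSpace ℝ E] (F : Pt n N → E)
    (h : ∀ z w : Pt n N, z.1 = w.1 → z.2.1 = w.2.1 → F z = F w) (y z : Pt n N)
    (h1 : y.1 = z.1) (h2 : y.2.1 = z.2.1) : fderiv ℝ F y = fderiv ℝ F z := by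
  have e : y = z + (y - z) := by abel
  rw [e]
  apply fderiv_shift
  intro u
  apply h
  · simp [h1]
  · simp [h2]

/-- all values of the derivative satisfy the algebraic conditions -/
def AllCoefs (X : Pt n N → Pt n N) : Prop :=
  ∀ z, Coefs (fderiv ℝ X z : Pt n N →ₗ[ℝ] Pt n N)

lemma fwd1 {X : Pt n N → Pt n N} (hX : Differentiable ℝ X) (hC : AllCoefs X)
    (z w : Pt n N) (h : z.1 = w.1) : (X z).1 = (X w).1 := by
  funext μ
  have := line_const (F := fun y => (X y).1 μ) (by fun_prop) w (z - w) 0 (by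
    intro s
    rw [fd_x hX]
    have := (hC (w + s • (z - w))).c1 (z - w) (by simp [h])
    exact congrFun this μ)
  simpa using this

lemma fwd2 {X : Pt n N → Pt n N} (hX : Differentiable ℝ X) (hC : AllCoefs X)
    (z w : Pt n N) (h : z.1 = w.1) (h' : z.2.1 = w.2.1) : (X z).2.1 = (X w).2.1 := by
  funext i
  have := line_const (F := fun y => (X y).2.1 i) (by fun_prop) w (z - w) 0 (by
    intro s
    rw [fd_q hX]
    have := (hC (w + s • (z - w))).cq_exp i (z - w)
    simp only [cx, cq, Prod.fst_sub, Prod.snd_sub, h, h'] at this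
    simpa using this)
  simpa using this

lemma fwd3 {X : Pt n N → Pt n N} (hX : Differentiable ℝ X) (hC : AllCoefs X)
    (z : Pt n N) (i : Fin N) (μ : Fin (n+2)) :
    (X z).2.2.1 i μ =
             - (∑ j : Fin N, z.2.2.1 j μ * pdq n N (fun y => (X y).2.1 j) z i)
             + (∑ ν : Fin (n+2), z.2.2.1 i ν * pdx n N (fun y => (X y).1 μ) z ν)
             - z.2.2.1 i μ * (∑ ν : Fin (n+2), pdx n N (fun y => (X y).1 ν) z ν)
             + (X (z.1, z.2.1, 0, 0)).2.2.1 i μ := by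
  have := line_const (F := fun y => (X y).2.2.1 i μ) (by fun_prop) (z.1, z.2.1, 0, 0)
    (0, 0, z.2.2.1, z.2.2.2)
    (- (∑ j : Fin N, z.2.2.1 j μ * pdq n N (fun y => (X y).2.1 j) z i)
             + (∑ ν : Fin (n+2), z.2.2.1 i ν * pdx n N (fun y => (X y).1 μ) z ν)
             - z.2.2.1 i μ * (∑ ν : Fin (n+2), pdx n N (fun y => (X y).1 ν) z ν)) (by
    intro s
    set y : Pt n N := (z.1, z.2.1, 0, 0) + s • (0, 0, z.2.2.1, z.2.2.2) with hy
    have y1 : z.1 = y.1 := by simp [hy]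
    have y2 : z.2.1 = y.2.1 := by simp [hy]
    rw [fd_p hX]
    have := (hC y).cp_exp i μ (0, 0, z.2.2.1, z.2.2.2)
    simp only [cp, cq, cx, ContinuousLinearMap.coe_coe] at this
    rw [this]
    simp only [pdq, pdx]
    simp only [fun j => fderiv_dep (fun y => (X y).2.1 j)
      (fun u v hu hv => congrFun (fwd2 hX hC u v hu hv) j) z y y1 y2,
      fun j => fderiv_dep (fun y => (X y).1 j)
      (fun u v hu _ => congrFun (fwd1 hX hC u v hu) j) z y y1 y2, fd_x hX, fd_q hX]
    simp [mul_comm])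
  have e : z = (z.1, z.2.1, 0, 0) + (0, 0, z.2.2.1, z.2.2.2) := by ext <;> simp
  rw [← e] at this
  rw [this]; ring

lemma fwd4 {X : Pt n N → Pt n N} (hX : Differentiable ℝ X) (hC : AllCoefs X)
    (z : Pt n N)  :
    (X z).2.2.2 =
             - z.2.2.2 * (∑ μ : Fin (n+2), pdx n N (fun y => (X y).1 μ) z μ)
             - (∑ i : Fin N, ∑ μ : Fin (n+2),
                 z.2.2.1 i μ * pdx n N (fun y => (X y).2.1 i) z μ)
             + (X (z.1, z.2.1, 0, 0)).2.2.2 := by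
  have := line_const (F := fun y => (X y).2.2.2) (by fun_prop) (z.1, z.2.1, 0, 0)
    (0, 0, z.2.2.1, z.2.2.2)
    (- z.2.2.2 * (∑ μ : Fin (n+2), pdx n N (fun y => (X y).1 μ) z μ)
             - (∑ i : Fin N, ∑ μ : Fin (n+2),
                 z.2.2.1 i μ * pdx n N (fun y => (X y).2.1 i) z μ)) (by
    intro s
    set y : Pt n N := (z.1, z.2.1, 0, 0) + s • (0, 0, z.2.2.1, z.2.2.2) with hy
    have y1 : z.1 = y.1 := by simp [hy]
    have y2 : z.2.1 = y.2.1 := by simp [hy]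
    rw [fd_E hX]
    have := (hC y).cE_exp (0, 0, z.2.2.1, z.2.2.2)
    simp only [cp, cq, cx, cE, ContinuousLinearMap.coe_coe] at this
    rw [this]
    simp only [pdx]
    simp only [fun j => fderiv_dep (fun y => (X y).2.1 j)
      (fun u v hu hv => congrFun (fwd2 hX hC u v hu hv) j) z y y1 y2,
      fun j => fderiv_dep (fun y => (X y).1 j)
      (fun u v hu _ => congrFun (fwd1 hX hC u v hu) j) z y y1 y2, fd_x hX, fd_q hX]
    simp [mul_comm]
    ring)
  have e : z = (z.1, z.2.1, 0, 0) + (0, 0, z.2.2.1, z.2.2.2) := by ext <;> simp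
  rw [← e] at this
  rw [this]; ring

end main
end MPS


namespace MPS
section homotopy
variable {n N : ℕ}

/-- radial contraction in the field variables -/
def pr (t : ℝ) (z : Pt n N) : Pt n N := (z.1, t • z.2.1, 0, 0)
/-- contraction in the first base variable -/
noncomputable def sg (t : ℝ) (z : Pt n N) : Pt n N :=
  (z.1 + ((t - 1) * z.1 0) • Pi.single 0 1, 0, 0, 0)

lemma pr_line (t s : ℝ) (z a : Pt n N) : pr t (z + s • a) = pr t z + s • pr t a := by
  ext <;> simp [pr]; ring
lemma sg_line (t s : ℝ) (z a : Pt n N) : sg t (z + s • a) = sg t z + s • sg t a := by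
  ext <;> simp [sg]; ring
lemma pr_eq (t : ℝ) (i : Fin N) : pr t (eq n N i) = t • eq n N i := by
  ext <;> simp [pr, eq]
lemma pr_ex (t : ℝ) (i : Fin (n+2)) : pr t (ex n N i) = ex n N i := by
  ext <;> simp [pr, ex]
lemma sg_eq (t : ℝ) (i : Fin N) : sg t (eq n N i) = 0 := by
  ext <;> simp [sg, eq]
lemma sg_ex (t : ℝ) : sg t (ex n N 0) = t • ex n N 0 := by
  ext <;> simp [sg, ex]; ring

lemma pr_deriv (z : Pt n N) (t : ℝ) :
    HasDerivAt (fun t => pr t z) (0, z.2.1, 0, 0) t := by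
  have e : (fun t => pr t z) = fun t => ((z.1, 0, 0, 0) : Pt n N) + t • ((0, z.2.1, 0, 0) : Pt n N) := by
    funext t; ext <;> simp [pr]
  rw [e]
  simpa using ((hasDerivAt_id t).smul_const ((0, z.2.1, 0, 0) : Pt n N)).const_add (z.1, 0, 0, 0)

lemma sg_deriv (z : Pt n N) (t : ℝ) :
    HasDerivAt (fun t => sg t z) (z.1 0 • ex n N 0) t := by
  have e : (fun t => sg t z) = fun t => sg 0 z + t • (z.1 0 • ex n N 0) := by
    funext t; ext <;> simp [sg, ex]; ring
  rw [e]
  simpa using ((hasDerivAt_id t).smul_const (z.1 0 • ex n N 0)).const_add (sg 0 z)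

noncomputable def GF (X : Pt n N → Pt n N) (μ : Fin (n+2)) (p : ℝ × Pt n N) : ℝ :=
  ∑ k, Lq k p.2 * Lp k μ (X (pr p.1 p.2))
noncomputable def GK (X : Pt n N → Pt n N) (p : ℝ × Pt n N) : ℝ :=
  Lx 0 p.2 * LE (X (sg p.1 p.2))

lemma pr_smooth : ContDiff ℝ (⊤ : ℕ∞) (fun p : ℝ × Pt n N => pr p.1 p.2) := by
  unfold pr; fun_prop
lemma sg_smooth : ContDiff ℝ (⊤ : ℕ∞) (fun p : ℝ × Pt n N => sg p.1 p.2) := by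
  unfold sg; fun_prop

lemma GF_smooth {X : Pt n N → Pt n N} (hX : ContDiff ℝ (⊤ : ℕ∞) X) (μ : Fin (n+2)) :
    ContDiff ℝ (⊤ : ℕ∞) (GF X μ) := by
  have := pr_smooth (n := n) (N := N)
  unfold GF
  fun_prop
lemma GK_smooth {X : Pt n N → Pt n N} (hX : ContDiff ℝ (⊤ : ℕ∞) X) :
    ContDiff ℝ (⊤ : ℕ∞) (GK X) := by
  have := sg_smooth (n := n) (N := N)
  unfold GK
  fun_prop

lemma lin_line (L : Pt n N →L[ℝ] ℝ) (z a : Pt n N) :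
    HasDerivAt (fun s : ℝ => L (z + s • a)) (L a) 0 := by
  have h1 : HasDerivAt (fun s : ℝ => z + s • a) a 0 := by
    simpa using ((hasDerivAt_id (0:ℝ)).smul_const a).const_add z
  exact L.hasFDerivAt.comp_hasDerivAt 0 h1

lemma id_line (z a : Pt n N) (s : ℝ) : HasDerivAt (fun s : ℝ => z + s • a) a s := by
  simpa using ((hasDerivAt_id s).smul_const a).const_add z

lemma GF_line {X : Pt n N → Pt n N} (hX : Differentiable ℝ X) (μ : Fin (n+2)) (z a : Pt n N)
    (t : ℝ) : HasDerivAt (fun s : ℝ => GF X μ (t, z + s • a))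
      (∑ k, (Lq k a * Lp k μ (X (pr t z)) + Lq k z * Lp k μ (fderiv ℝ X (pr t z) (pr t a)))) 0 := by
  unfold GF
  apply HasDerivAt.fun_sum
  intro k _
  have h1 := lin_line (Lq k) z a
  have h2 := hasDerivAt_lin hX (Lp k μ) (fun s : ℝ => pr t (z + s • a)) (pr t a) 0 (by
    simp only [pr_line]; exact id_line _ _ _)
  have := h1.fun_mul h2
  simpa using this

lemma GK_line {X : Pt n N → Pt n N} (hX : Differentiable ℝ X) (z a : Pt n N)
    (t : ℝ) : HasDerivAt (fun s : ℝ => GK X (t, z + s • a))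
      (Lx 0 a * LE (X (sg t z)) + Lx 0 z * LE (fderiv ℝ X (sg t z) (sg t a))) 0 := by
  unfold GK
  have h1 := lin_line (Lx 0) z a
  have h2 := hasDerivAt_lin hX LE (fun s : ℝ => sg t (z + s • a)) (sg t a) 0 (by
    simp only [sg_line]; exact id_line _ _ _)
  have := h1.fun_mul h2
  simpa using this

noncomputable def FF (X : Pt n N → Pt n N) (μ : Fin (n+2)) (z : Pt n N) : ℝ :=
  ∫ t in (0:ℝ)..1, GF X μ (t, z)
noncomputable def KK (X : Pt n N → Pt n N) (z : Pt n N) : ℝ :=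
  ∫ t in (0:ℝ)..1, GK X (t, z)

lemma KK_q {X : Pt n N → Pt n N} (hX : ContDiff ℝ (⊤ : ℕ∞) X) (z : Pt n N) (i : Fin N) :
    fderiv ℝ (KK X) z (eq n N i) = 0 := by
  have hd := hX.differentiable (by simp)
  have := fderiv_param (GK X) (GK_smooth hX) z (eq n N i) _ (GK_line hd z (eq n N i))
  refine this.trans ?_
  have e : (eq n N i).1 0 = 0 := rfl
  simp [sg_eq, Lx_apply, e]

lemma cont_pr {X : Pt n N → Pt n N} (hX : ContDiff ℝ (⊤ : ℕ∞) X) (z a : Pt n N) :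
    Continuous fun t => fderiv ℝ X (pr t z) a := by
  have h1 : Continuous (fderiv ℝ X) := hX.continuous_fderiv (by simp)
  have h2 : Continuous fun t => pr t z := (pr_smooth (n := n) (N := N)).continuous.comp
    (by fun_prop : Continuous fun t : ℝ => (t, z))
  have := h1.comp h2
  exact this.clm_apply continuous_const

lemma cont_sg {X : Pt n N → Pt n N} (hX : ContDiff ℝ (⊤ : ℕ∞) X) (z a : Pt n N) :
    Continuous fun t => fderiv ℝ X (sg t z) a := by
  have h1 : Continuous (fderiv ℝ X) := hX.continuous_fderiv (by simp)
  have h2 : Continuous fun t => sg t z := (sg_smooth (n := n) (N := N)).continuous.comp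
    (by fun_prop : Continuous fun t : ℝ => (t, z))
  have := h1.comp h2
  exact this.clm_apply continuous_const

lemma cont_pr0 {X : Pt n N → Pt n N} (hX : ContDiff ℝ (⊤ : ℕ∞) X) (z : Pt n N) :
    Continuous fun t => X (pr t z) :=
  hX.continuous.comp ((pr_smooth (n := n) (N := N)).continuous.comp
    (by fun_prop : Continuous fun t : ℝ => (t, z)))
lemma cont_sg0 {X : Pt n N → Pt n N} (hX : ContDiff ℝ (⊤ : ℕ∞) X) (z : Pt n N) :
    Continuous fun t => X (sg t z) :=
  hX.continuous.comp ((sg_smooth (n := n) (N := N)).continuous.comp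
    (by fun_prop : Continuous fun t : ℝ => (t, z)))

lemma KK_x {X : Pt n N → Pt n N} (hX : ContDiff ℝ (⊤ : ℕ∞) X) (z : Pt n N) :
    fderiv ℝ (KK X) z (ex n N 0) = (X (z.1, 0, 0, 0)).2.2.2 := by
  have hd := hX.differentiable (by simp)
  have := fderiv_param (GK X) (GK_smooth hX) z (ex n N 0) _ (GK_line hd z (ex n N 0))
  refine this.trans ?_
  have hc := cont_sg hX z (ex n N 0)
  have hc0 := cont_sg0 hX z
  rw [intervalIntegral.integral_eq_sub_of_hasDerivAt (f := fun t => t * LE (X (sg t z)))]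
  · simp [sg, LE_apply]
  · intro t _
    have := (hasDerivAt_id t).fun_mul (hasDerivAt_lin hd LE (fun s : ℝ => sg s z) _ t (sg_deriv z t))
    refine HasDerivAt.congr_deriv this ?_
    have e : (ex n N 0).1 0 = 1 := by simp [ex]
    simp [sg_ex, Lx_apply, e]
    ring
  · apply Continuous.intervalIntegrable
    simp only [sg_ex, map_smul]
    exact (continuous_const.mul (LE.continuous.comp hc0)).add
      (continuous_const.mul (continuous_id.smul (LE.continuous.comp hc)))

lemma FF_q {X : Pt n N → Pt n N} (hX : ContDiff ℝ (⊤ : ℕ∞) X) (hC : AllCoefs X) (μ : Fin (n+2))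
    (z : Pt n N) (i : Fin N) :
    fderiv ℝ (FF X μ) z (eq n N i) = (X (z.1, z.2.1, 0, 0)).2.2.1 i μ := by
  have hd := hX.differentiable (by simp)
  have := fderiv_param (GF X μ) (GF_smooth hX μ) z (eq n N i) _ (GF_line hd μ z (eq n N i))
  refine this.trans ?_
  have hc := cont_pr hX z (eq n N i)
  have hc0 := cont_pr0 hX z
  rw [intervalIntegral.integral_eq_sub_of_hasDerivAt (f := fun t => t * Lp i μ (X (pr t z)))]
  · simp [pr, Lp_apply]
  · intro t _
    have := (hasDerivAt_id t).fun_mul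
      (hasDerivAt_lin hd (Lp i μ) (fun s : ℝ => pr s z) _ t (pr_deriv z t))
    refine HasDerivAt.congr_deriv this ?_
    have h := (hC (pr t z)).cp_exp i μ (0, z.2.1, 0, 0)
    have hs := (hC (pr t z)).p_q i
    simp only [cp, cq, cx, ContinuousLinearMap.coe_coe] at h hs
    simp only [Lp_apply, h, Finset.sum_add_distrib, pr_eq, map_smul, Prod.smul_snd, Prod.smul_fst,
      Pi.smul_apply, smul_eq_mul, hs]
    simp [Lq_apply, eq, Pi.single_apply, Finset.mul_sum]
    refine Finset.sum_congr rfl fun k _ => ?_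
    ring
  · apply Continuous.intervalIntegrable
    simp only [pr_eq, map_smul]
    exact continuous_finsetSum _ fun k _ =>
      (continuous_const.mul ((Lp k μ).continuous.comp hc0)).add
        (continuous_const.mul (continuous_id.smul ((Lp k μ).continuous.comp hc)))

lemma FF_x {X : Pt n N → Pt n N} (hX : ContDiff ℝ (⊤ : ℕ∞) X) (hC : AllCoefs X)
    (z : Pt n N) :
    ∑ μ, fderiv ℝ (FF X μ) z (ex n N μ) =
      (X (z.1, z.2.1, 0, 0)).2.2.2 - (X (z.1, 0, 0, 0)).2.2.2 := by
  have hd := hX.differentiable (by simp)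
  have h1 : ∀ μ, fderiv ℝ (FF X μ) z (ex n N μ) = _ := fun μ =>
    fderiv_param (GF X μ) (GF_smooth hX μ) z (ex n N μ) _ (GF_line hd μ z (ex n N μ))
  have hc := cont_pr hX z
  have hc0 := cont_pr0 hX z
  simp only [h1]
  rw [← intervalIntegral.integral_finsetSum]
  · rw [intervalIntegral.integral_eq_sub_of_hasDerivAt (f := fun t => LE (X (pr t z)))]
    · simp [pr, LE_apply]
    · intro t _
      have := (hasDerivAt_lin hd LE (fun s : ℝ => pr s z) _ t (pr_deriv z t))
      refine HasDerivAt.congr_deriv this ?_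
      have h := (hC (pr t z)).cE_exp (0, z.2.1, 0, 0)
      simp only [cp, cq, cx, cE, ContinuousLinearMap.coe_coe] at h
      simp only [LE_apply, h, pr_ex]
      simp [Lq_apply, ex, Lp_apply, Finset.sum_mul]
      rw [Finset.sum_comm]
      simp only [mul_comm]
    · apply Continuous.intervalIntegrable
      simp only [pr_ex]
      exact continuous_finsetSum _ fun μ _ => continuous_finsetSum _ fun k _ =>
        (continuous_const.mul ((Lp k μ).continuous.comp hc0)).add
          (continuous_const.mul ((Lp k μ).continuous.comp (hc _)))
  · intro μ _
    apply Continuous.intervalIntegrable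
    simp only [pr_ex]
    exact continuous_finsetSum _ fun k _ =>
      (continuous_const.mul ((Lp k μ).continuous.comp hc0)).add
        (continuous_const.mul ((Lp k μ).continuous.comp (hc _)))

noncomputable def f00 (X : Pt n N → Pt n N) (z : Pt n N) (μ : Fin (n+2)) : ℝ :=
  FF X μ z + (if μ = 0 then 1 else 0) * KK X z

lemma f00_smooth {X : Pt n N → Pt n N} (hX : ContDiff ℝ (⊤ : ℕ∞) X) :
    ContDiff ℝ (⊤ : ℕ∞) (f00 X) := by
  rw [contDiff_pi]
  intro μ
  have h1 : ContDiff ℝ (⊤ : ℕ∞) (FF X μ) := contDiff_param _ (GF_smooth hX μ)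
  have h2 : ContDiff ℝ (⊤ : ℕ∞) (KK X) := contDiff_param _ (GK_smooth hX)
  unfold f00
  fun_prop

lemma f00_fd {X : Pt n N → Pt n N} (hX : ContDiff ℝ (⊤ : ℕ∞) X) (μ : Fin (n+2)) (z a : Pt n N) :
    fderiv ℝ (fun y => f00 X y μ) z a
      = fderiv ℝ (FF X μ) z a + (if μ = 0 then 1 else 0) * fderiv ℝ (KK X) z a := by
  have h1 : ContDiff ℝ (⊤ : ℕ∞) (FF X μ) := contDiff_param _ (GF_smooth hX μ)
  have h2 : ContDiff ℝ (⊤ : ℕ∞) (KK X) := contDiff_param _ (GK_smooth hX)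
  have d1 := h1.differentiable (by simp) z
  have d2 := h2.differentiable (by simp) z
  unfold f00
  rw [fderiv_fun_add d1 (d2.const_mul _), fderiv_const_mul d2]
  rfl

lemma f00_dep {X : Pt n N → Pt n N} (z w : Pt n N) (h1 : z.1 = w.1) (h2 : z.2.1 = w.2.1) :
    f00 X z = f00 X w := by
  funext μ
  simp [f00, FF, KK, GF, GK, pr, sg, h1, h2, Lq_apply, Lx_apply]

end homotopy
end MPS


namespace MPS
section backward
variable {n N : ℕ}

lemma bwd_x {X : Pt n N → Pt n N} (hX : Differentiable ℝ X)
    (h1 : ∀ z w : Pt n N, z.1 = w.1 → (X z).1 = (X w).1) (z a : Pt n N) (ha : a.1 = 0) :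
    (fderiv ℝ X z a).1 = 0 := by
  funext μ
  rw [← fd_x hX]
  apply fderiv_of_line (F := fun y => (X y).1 μ) (by fun_prop)
  have e : (fun s : ℝ => (X (z + s • a)).1 μ) = fun _ => (X z).1 μ := by
    funext s
    rw [h1 (z + s • a) z (by simp [ha])]
  rw [e]
  exact hasDerivAt_const _ _

lemma bwd_q {X : Pt n N → Pt n N} (hX : Differentiable ℝ X)
    (h2 : ∀ z w : Pt n N, z.1 = w.1 → z.2.1 = w.2.1 → (X z).2.1 = (X w).2.1) (z a : Pt n N)
    (ha : a.1 = 0) (ha' : a.2.1 = 0) :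
    (fderiv ℝ X z a).2.1 = 0 := by
  funext μ
  rw [← fd_q hX]
  apply fderiv_of_line (F := fun y => (X y).2.1 μ) (by fun_prop)
  have e : (fun s : ℝ => (X (z + s • a)).2.1 μ) = fun _ => (X z).2.1 μ := by
    funext s
    rw [h2 (z + s • a) z (by simp [ha]) (by simp [ha'])]
  rw [e]
  exact hasDerivAt_const _ _

lemma affine_deriv (b c : ℝ) : HasDerivAt (fun s : ℝ => b + s * c) c 0 := by
  simpa using ((hasDerivAt_id (0:ℝ)).mul_const c).const_add b

/-- second derivative -/
noncomputable def D2 (F : Pt n N → ℝ) (z a b : Pt n N) : ℝ :=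
  fderiv ℝ (fun y => fderiv ℝ F y b) z a

lemma D2_symm {F : Pt n N → ℝ} (hF : ContDiff ℝ (⊤ : ℕ∞) F) (z a b : Pt n N) :
    D2 F z a b = D2 F z b a := snd_symm hF z b a

lemma D2_line {F : Pt n N → ℝ} (hF : ContDiff ℝ (⊤ : ℕ∞) F) (z a b : Pt n N) :
    HasDerivAt (fun s : ℝ => fderiv ℝ F (z + s • a) b) (D2 F z a b) 0 := by
  have hd : Differentiable ℝ (fderiv ℝ F) :=
    ((contDiff_infty.1 hF 2).fderiv_right (m := 1) (by norm_num)).differentiable one_ne_zero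
  have := hasDerivAt_line (F := fun y => fderiv ℝ F y b) (by fun_prop) z a 0
  simpa [D2] using this

/-- the right hand side of the classification -/
structure Rhs (X : Pt n N → Pt n N) (f0 : Pt n N → Fin (n+2) → ℝ) : Prop where
  hX : ContDiff ℝ (⊤ : ℕ∞) X
  h1 : ∀ z w : Pt n N, z.1 = w.1 → (X z).1 = (X w).1
  h2 : ∀ z w : Pt n N, z.1 = w.1 → z.2.1 = w.2.1 → (X z).2.1 = (X w).2.1
  hf : ContDiff ℝ (⊤ : ℕ∞) f0
  hfd : ∀ z w : Pt n N, z.1 = w.1 → z.2.1 = w.2.1 → f0 z = f0 w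
  hp : ∀ (z : Pt n N) (i : Fin N) (μ : Fin (n+2)),
           (X z).2.2.1 i μ =
             - (∑ j : Fin N, z.2.2.1 j μ * pdq n N (fun y => (X y).2.1 j) z i)
             + (∑ ν : Fin (n+2), z.2.2.1 i ν * pdx n N (fun y => (X y).1 μ) z ν)
             - z.2.2.1 i μ * (∑ ν : Fin (n+2), pdx n N (fun y => (X y).1 ν) z ν)
             + pdq n N (fun y => f0 y μ) z i
  hE : ∀ z : Pt n N,
           (X z).2.2.2 =
             - z.2.2.2 * (∑ μ : Fin (n+2), pdx n N (fun y => (X y).1 μ) z μ)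
             - (∑ i : Fin N, ∑ μ : Fin (n+2),
                 z.2.2.1 i μ * pdx n N (fun y => (X y).2.1 i) z μ)
             + (∑ μ : Fin (n+2), pdx n N (fun y => f0 y μ) z μ)

variable {X : Pt n N → Pt n N} {f0 : Pt n N → Fin (n+2) → ℝ}

lemma Rhs.d (h : Rhs X f0) : Differentiable ℝ X := h.hX.differentiable (by simp)

lemma Rhs.pv (h : Rhs X f0) (z a : Pt n N) (ha : a.1 = 0) (ha' : a.2.1 = 0) (i : Fin N)
    (μ : Fin (n+2)) :
    (fderiv ℝ X z a).2.2.1 i μ =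
             - (∑ j : Fin N, a.2.2.1 j μ * (fderiv ℝ X z (eq n N i)).2.1 j)
             + (∑ ν : Fin (n+2), a.2.2.1 i ν * (fderiv ℝ X z (ex n N ν)).1 μ)
             - a.2.2.1 i μ * (∑ ν : Fin (n+2), (fderiv ℝ X z (ex n N ν)).1 ν) := by
  have hd := h.d
  rw [← fd_p hd]
  apply fderiv_of_line (F := fun y => (X y).2.2.1 i μ) (by fun_prop)
  refine HasDerivAt.congr_of_eventuallyEq (affine_deriv ((X z).2.2.1 i μ) _)
    (Filter.Eventually.of_forall fun s => ?_)
  have y1 : (z + s • a).1 = z.1 := by simp [ha]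
  have y2 : (z + s • a).2.1 = z.2.1 := by simp [ha']
  simp only [h.hp, pdq, pdx]
  simp only [fun j => fderiv_dep (fun y => (X y).2.1 j)
      (fun u v hu hv => congrFun (h.h2 u v hu hv) j) (z + s • a) z y1 y2,
      fun j => fderiv_dep (fun y => (X y).1 j)
      (fun u v hu _ => congrFun (h.h1 u v hu) j) (z + s • a) z y1 y2,
      fun j => fderiv_dep (fun y => f0 y j)
      (fun u v hu hv => congrFun (h.hfd u v hu hv) j) (z + s • a) z y1 y2, fd_x hd, fd_q hd]
  simp only [Prod.snd_add, Prod.fst_add, Prod.smul_snd, Prod.smul_fst, Pi.add_apply, Pi.smul_apply,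
    smul_eq_mul, add_mul, Finset.sum_add_distrib, mul_assoc, ← Finset.mul_sum]
  ring

lemma Rhs.Ev (h : Rhs X f0) (z a : Pt n N) (ha : a.1 = 0) (ha' : a.2.1 = 0) :
    (fderiv ℝ X z a).2.2.2 =
             - a.2.2.2 * (∑ μ : Fin (n+2), (fderiv ℝ X z (ex n N μ)).1 μ)
             - (∑ i : Fin N, ∑ μ : Fin (n+2),
                 a.2.2.1 i μ * (fderiv ℝ X z (ex n N μ)).2.1 i) := by
  have hd := h.d
  rw [← fd_E hd]
  apply fderiv_of_line (F := fun y => (X y).2.2.2) (by fun_prop)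
  refine HasDerivAt.congr_of_eventuallyEq (affine_deriv ((X z).2.2.2) _)
    (Filter.Eventually.of_forall fun s => ?_)
  have y1 : (z + s • a).1 = z.1 := by simp [ha]
  have y2 : (z + s • a).2.1 = z.2.1 := by simp [ha']
  simp only [h.hE, pdx]
  simp only [fun j => fderiv_dep (fun y => (X y).2.1 j)
      (fun u v hu hv => congrFun (h.h2 u v hu hv) j) (z + s • a) z y1 y2,
      fun j => fderiv_dep (fun y => (X y).1 j)
      (fun u v hu _ => congrFun (h.h1 u v hu) j) (z + s • a) z y1 y2,
      fun j => fderiv_dep (fun y => f0 y j)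
      (fun u v hu hv => congrFun (h.hfd u v hu hv) j) (z + s • a) z y1 y2, fd_x hd, fd_q hd]
  simp only [Prod.snd_add, Prod.fst_add, Prod.smul_snd, Prod.smul_fst, Pi.add_apply, Pi.smul_apply,
    smul_eq_mul, add_mul, Finset.sum_add_distrib, mul_assoc, ← Finset.mul_sum]
  ring

lemma Rhs.sx (h : Rhs X f0) (μ : Fin (n+2)) : ContDiff ℝ (⊤ : ℕ∞) (fun y => (X y).1 μ) :=
  (Lx μ).contDiff.comp h.hX
lemma Rhs.sq (h : Rhs X f0) (i : Fin N) : ContDiff ℝ (⊤ : ℕ∞) (fun y => (X y).2.1 i) :=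
  (Lq i).contDiff.comp h.hX
lemma Rhs.sf (h : Rhs X f0) (μ : Fin (n+2)) : ContDiff ℝ (⊤ : ℕ∞) (fun y => f0 y μ) :=
  contDiff_pi.1 h.hf μ

lemma Rhs.ph (h : Rhs X f0) (z a : Pt n N) (ha : a.2.2 = 0) (i : Fin N)
    (μ : Fin (n+2)) :
    (fderiv ℝ X z a).2.2.1 i μ =
             - (∑ j : Fin N, z.2.2.1 j μ * D2 (fun y => (X y).2.1 j) z a (eq n N i))
             + (∑ ν : Fin (n+2), z.2.2.1 i ν * D2 (fun y => (X y).1 μ) z a (ex n N ν))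
             - z.2.2.1 i μ * (∑ ν : Fin (n+2), D2 (fun y => (X y).1 ν) z a (ex n N ν))
             + D2 (fun y => f0 y μ) z a (eq n N i) := by
  have hd := h.d
  rw [← fd_p hd]
  apply fderiv_of_line (F := fun y => (X y).2.2.1 i μ) (by fun_prop)
  simp only [h.hp, pdq, pdx]
  have e : ∀ s : ℝ, (z + s • a).2.2 = z.2.2 := by intro s; simp [ha]
  simp only [e]
  refine HasDerivAt.fun_add (HasDerivAt.fun_sub (HasDerivAt.fun_add (HasDerivAt.fun_neg
    (HasDerivAt.fun_sum fun j _ => ?_)) (HasDerivAt.fun_sum fun j _ => ?_))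
    (HasDerivAt.const_mul _ (HasDerivAt.fun_sum fun j _ => ?_))) ?_
  · exact (D2_line (h.sq j) z a _).const_mul _
  · exact (D2_line (h.sx μ) z a _).const_mul _
  · exact D2_line (h.sx j) z a _
  · exact D2_line (h.sf μ) z a _

lemma Rhs.Eh (h : Rhs X f0) (z a : Pt n N) (ha : a.2.2 = 0) :
    (fderiv ℝ X z a).2.2.2 =
             - z.2.2.2 * (∑ μ : Fin (n+2), D2 (fun y => (X y).1 μ) z a (ex n N μ))
             - (∑ i : Fin N, ∑ μ : Fin (n+2),
                 z.2.2.1 i μ * D2 (fun y => (X y).2.1 i) z a (ex n N μ))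
             + (∑ μ : Fin (n+2), D2 (fun y => f0 y μ) z a (ex n N μ)) := by
  have hd := h.d
  rw [← fd_E hd]
  apply fderiv_of_line (F := fun y => (X y).2.2.2) (by fun_prop)
  simp only [h.hE, pdx]
  have e : ∀ s : ℝ, (z + s • a).2.2 = z.2.2 := by intro s; simp [ha]
  simp only [e]
  refine HasDerivAt.fun_add (HasDerivAt.fun_sub
    (HasDerivAt.const_mul _ (HasDerivAt.fun_sum fun j _ => ?_))
    (HasDerivAt.fun_sum fun j _ => HasDerivAt.fun_sum fun k _ => ?_))
    (HasDerivAt.fun_sum fun j _ => ?_)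
  · exact D2_line (h.sx j) z a _
  · exact (D2_line (h.sq j) z a _).const_mul _
  · exact D2_line (h.sf j) z a _

lemma Rhs.D2x (h : Rhs X f0) (z b : Pt n N) (k : Fin N) (μ : Fin (n+2)) :
    D2 (fun y => (X y).1 μ) z (eq n N k) b = 0 := by
  rw [D2_symm (h.sx μ), D2]
  have : (fun y => fderiv ℝ (fun y => (X y).1 μ) y (eq n N k)) = fun _ => 0 := by
    funext y
    rw [fd_x h.d, bwd_x h.d h.h1 y _ rfl]
    rfl
  rw [this]
  simp

lemma Rhs.coefs (h : Rhs X f0) : AllCoefs X := by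
  intro z
  have hd := h.d
  constructor
  · intro k; exact bwd_x hd h.h1 z _ rfl
  · intro j ρ; exact bwd_x hd h.h1 z _ rfl
  · exact bwd_x hd h.h1 z _ rfl
  · intro j ρ; exact bwd_q hd h.h2 z _ rfl rfl
  · exact bwd_q hd h.h2 z _ rfl rfl
  · intro j ρ i μ
    simp only [ContinuousLinearMap.coe_coe]
    rw [h.pv z _ rfl rfl]
    have e : ∀ k ν, (ep n N j ρ).2.2.1 k ν = if k = j then (if ν = ρ then 1 else 0) else 0 :=
      fun k ν => single_single _ _ _ _
    simp only [e]
    by_cases h1 : i = j <;> by_cases h2 : μ = ρ <;> simp [h1, h2]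
    ring
  · intro i μ
    simp only [ContinuousLinearMap.coe_coe]
    rw [h.pv z _ rfl rfl]
    simp [eE]
  · intro i k μ
    simp only [ContinuousLinearMap.coe_coe]
    rw [h.ph z _ rfl, h.ph z _ rfl]
    simp only [h.D2x, D2_symm (h.sf μ) z (eq n N k), fun j => D2_symm (h.sq j) z (eq n N k)]
    simp
  · simp only [ContinuousLinearMap.coe_coe]
    rw [h.Ev z _ rfl rfl]
    simp [eE]
  · intro i μ
    simp only [ContinuousLinearMap.coe_coe]
    rw [h.Ev z _ rfl rfl]
    have e : ∀ k ν, (ep n N i μ).2.2.1 k ν = if k = i then (if ν = μ then 1 else 0) else 0 :=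
      fun k ν => single_single _ _ _ _
    have e' : (ep n N i μ).2.2.2 = 0 := rfl
    simp only [e, e']
    simp
  · intro i
    simp only [ContinuousLinearMap.coe_coe]
    rw [h.Eh z _ rfl]
    simp only [fun μ => h.ph z (ex n N μ) rfl, h.D2x, Finset.sum_add_distrib,
      Finset.sum_sub_distrib, Finset.sum_neg_distrib]
    have e1 : ∑ μ, ∑ ν, z.2.2.1 i ν * D2 (fun y => (X y).1 μ) z (ex n N μ) (ex n N ν)
        = ∑ μ, z.2.2.1 i μ * ∑ ν, D2 (fun y => (X y).1 ν) z (ex n N μ) (ex n N ν) := by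
      rw [Finset.sum_comm]
      refine Finset.sum_congr rfl fun ν _ => ?_
      rw [Finset.mul_sum]
      refine Finset.sum_congr rfl fun μ _ => ?_
      rw [D2_symm (h.sx μ)]
    have e2 : ∑ j, ∑ μ, z.2.2.1 j μ * D2 (fun y => (X y).2.1 j) z (eq n N i) (ex n N μ)
        = ∑ μ, ∑ j, z.2.2.1 j μ * D2 (fun y => (X y).2.1 j) z (ex n N μ) (eq n N i) := by
      rw [Finset.sum_comm]
      refine Finset.sum_congr rfl fun ν _ => Finset.sum_congr rfl fun j _ => ?_
      rw [D2_symm (h.sq j)]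
    rw [e1, e2]
    simp only [fun μ => D2_symm (h.sf μ) z (eq n N i)]
    simp

end backward

theorem main_iff (n N : ℕ) (hN : 1 < N)
    (X : Pt n N → Pt n N) (hX : ContDiff ℝ (⊤ : ℕ∞) X) :
    (∀ (z : Pt n N) (v : Fin (n+3) → Pt n N), lieD n N X (omega n N) z v = 0) ↔
      ∃ f0 : Pt n N → Fin (n+2) → ℝ, Rhs X f0 := by
  have hd : Differentiable ℝ X := hX.differentiable (by simp)
  constructor
  · intro h
    have hC : AllCoefs X := fun z =>
      (forward hN (fderiv ℝ X z : Pt n N →ₗ[ℝ] Pt n N) fun v => by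
        have := h z v
        rw [lieD_eq X hd] at this
        exact this).coefs
    refine ⟨f00 X, hX, fwd1 hd hC, fwd2 hd hC, f00_smooth hX, f00_dep, ?_, ?_⟩
    · intro z i μ
      rw [fwd3 hd hC]
      congr 1
      rw [pdq, f00_fd hX, FF_q hX hC, KK_q hX]
      simp
    · intro z
      rw [fwd4 hd hC]
      congr 1
      simp only [pdx, f00_fd hX, Finset.sum_add_distrib]
      rw [FF_x hX hC]
      simp [KK_x hX]
  · rintro ⟨f0, h⟩ z v
    rw [lieD_eq X hd]
    exact (h.coefs z).lop v

end MPS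


open MPS in
/-- classification of locally hamiltonian vector fields in the
multisymplectic case with `N > 1`: `L_X ω = 0` iff `X^μ` depends only on `x`,
`X^i` depends only on `(x,q)`, and there exist smooth functions `f_0^μ` of `(x,q)` with
`X_i^μ = − p_j^μ ∂X^j/∂q^i + p_i^ν ∂X^μ/∂x^ν − p_i^μ ∂X^ν/∂x^ν + ∂f_0^μ/∂q^i` and
`X_0 = − p ∂X^μ/∂x^μ − p_i^μ ∂X^i/∂x^μ + ∂f_0^μ/∂x^μ`. -/
theorem locHam_classification (n N : ℕ) (hN : 1 < N)
    (X : Pt n N → Pt n N) (hX : ContDiff ℝ (⊤ : ℕ∞) X) :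
    (∀ (z : Pt n N) (v : Fin (n+3) → Pt n N), lieD n N X (omega n N) z v = 0) ↔
      ((∀ z w : Pt n N, z.1 = w.1 → (X z).1 = (X w).1) ∧
       (∀ z w : Pt n N, z.1 = w.1 → z.2.1 = w.2.1 → (X z).2.1 = (X w).2.1) ∧
       ∃ f0 : Pt n N → Fin (n+2) → ℝ, ContDiff ℝ (⊤ : ℕ∞) f0 ∧
         (∀ z w : Pt n N, z.1 = w.1 → z.2.1 = w.2.1 → f0 z = f0 w) ∧
         (∀ (z : Pt n N) (i : Fin N) (μ : Fin (n+2)),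
           (X z).2.2.1 i μ =
             - (∑ j : Fin N, z.2.2.1 j μ * pdq n N (fun y => (X y).2.1 j) z i)
             + (∑ ν : Fin (n+2), z.2.2.1 i ν * pdx n N (fun y => (X y).1 μ) z ν)
             - z.2.2.1 i μ * (∑ ν : Fin (n+2), pdx n N (fun y => (X y).1 ν) z ν)
             + pdq n N (fun y => f0 y μ) z i) ∧
         (∀ z : Pt n N,
           (X z).2.2.2 =
             - z.2.2.2 * (∑ μ : Fin (n+2), pdx n N (fun y => (X y).1 μ) z μ)
             - (∑ i : Fin N, ∑ μ : Fin (n+2),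
                 z.2.2.1 i μ * pdx n N (fun y => (X y).2.1 i) z μ)
             + (∑ μ : Fin (n+2), pdx n N (fun y => f0 y μ) z μ))) := by
  rw [main_iff n N hN X hX]
  constructor
  · rintro ⟨f0, h⟩
    exact ⟨h.h1, h.h2, f0, h.hf, h.hfd, h.hp, h.hE⟩
  · rintro ⟨h1, h2, f0, hf, hfd, hp, hE⟩
    exact ⟨f0, hX, h1, h2, hf, hfd, hp, hE⟩
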